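/- arXiv:2307.12494 — 3 statements merged into one kernel-verified Lean document; each statement's English description precedes it below -/
import Mathlib

section
/- Fix constants 0 < c₁ ≤ c₂ and an integer n ≥ 1. There exist constants 0 < cₙ ≤ Cₙ and a₀ ∈ (0,1) such that for every a ∈ (0, a₀) and every bounded measurable set Ω ⊂ ℝ² that satisfies the sandwich hypothesis with constants c₁, c₂ at scale a, the n-th eigenvalue of the logarithmic potential operator satisfies cₙ · a² ≤ λₙ(Ω) ≤ Cₙ · a². -/
open MeasureTheory Real

noncomputable section

/-- Points of the plane. -/
abbrev Pt2 := EuclideanSpace ℝ (Fin 2)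

/-- The logarithmic kernel `-(1/(2π)) log |x - y|` in dimension 2. -/
def logKernel (x y : Pt2) : ℝ := -(1 / (2 * π)) * Real.log (dist x y)

/-- The logarithmic potential operator `N_Ω`. -/
def NOp (Ω : Set Pt2) (f : Pt2 → ℝ) (x : Pt2) : ℝ := ∫ y in Ω, logKernel x y * f y

/-- The quadratic form `⟨N_Ω u, u⟩` on `L²(Ω)`. -/
def quadForm (Ω : Set Pt2) (u : Lp ℝ 2 (volume.restrict Ω)) : ℝ :=
  ∫ x in Ω, NOp Ω u x * u x

/-- The `n`-th eigenvalue of the logarithmic potential operator, via the max–min principle: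
`λ_n(Ω) = sup` over `(n+1)`-dimensional subspaces `Ξ` of `L²(Ω)` of
`inf` over nonzero `u ∈ Ξ` of `⟨N_Ω u, u⟩ / ‖u‖²`. -/
def eigen2 (Ω : Set Pt2) (n : ℕ) : ℝ :=
  sSup {r : ℝ | ∃ Ξ : Submodule ℝ (Lp ℝ 2 (volume.restrict Ω)),
    Module.finrank ℝ ↥Ξ = n + 1 ∧
    r = sInf {q : ℝ | ∃ u ∈ Ξ, u ≠ 0 ∧ q = quadForm Ω u / ‖u‖ ^ 2}}

/-- The sandwich hypothesis: `Ω` is squeezed between two discs of radii comparable to `a`. -/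
def Sandwich (c₁ c₂ a : ℝ) (Ω : Set Pt2) : Prop :=
  ∃ (z₁ z₂ : Pt2) (ρ₁ ρ₂ : ℝ),
    c₁ * a ≤ ρ₁ ∧ ρ₁ ≤ c₂ * a ∧ c₁ * a ≤ ρ₂ ∧ ρ₂ ≤ c₂ * a ∧
    Metric.ball z₁ ρ₁ ⊆ Ω ∧ Ω ⊆ Metric.ball z₂ ρ₂

lemma logsq_integrable (R : ℝ) :
    Integrable (fun w : Pt2 => (Metric.ball (0:Pt2) R).indicator (fun w => Real.log ‖w‖ ^ 2) w) := by
  rw [integrable_indicator_iff Metric.isOpen_ball.measurableSet]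
  rw [integrableOn_fun_norm_addHaar (volume : Measure Pt2) (f := fun r => Real.log r ^ 2)]
  have hc : Continuous (fun y : ℝ => 4 * (Real.sqrt y * Real.log (Real.sqrt y)) ^ 2) := by
    have := Real.continuous_mul_log.comp Real.continuous_sqrt
    exact continuous_const.mul (this.pow 2)
  have h1 : IntegrableOn (fun y : ℝ => 4 * (Real.sqrt y * Real.log (Real.sqrt y)) ^ 2) (Set.Ioo 0 R) :=
    (hc.continuousOn.integrableOn_compact (isCompact_Icc (a := (0:ℝ)) (b := R))).mono_set Set.Ioo_subset_Icc_self
  refine h1.congr_fun ?_ measurableSet_Ioo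
  intro y hy
  have hy0 : 0 < y := hy.1
  simp only [finrank_euclideanSpace, Fintype.card_fin, smul_eq_mul]
  rw [Real.log_sqrt hy0.le, mul_pow, Real.sq_sqrt hy0.le]
  ring

def ell (a : ℝ) (x y : Pt2) : ℝ := Real.log ‖a⁻¹ • (x - y)‖

def MM (c : ℝ) : ℝ := ∫ w : Pt2, (Metric.ball (0:Pt2) (2*c)).indicator (fun w => Real.log ‖w‖ ^ 2) w

def VV : ℝ := (volume (Metric.ball (0:Pt2) 1)).toReal

lemma MM_nonneg (c : ℝ) : 0 ≤ MM c :=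
  integral_nonneg fun w => Set.indicator_nonneg (fun _ _ => sq_nonneg _) w

lemma VV_pos : 0 < VV :=
  ENNReal.toReal_pos (Metric.measure_ball_pos _ _ one_pos).ne' measure_ball_lt_top.ne

lemma vol_ball (z : Pt2) {r : ℝ} (hr : 0 ≤ r) : (volume (Metric.ball z r)).toReal = VV * r ^ 2 := by
  rw [Measure.addHaar_ball _ _ hr, ENNReal.toReal_mul, ENNReal.toReal_ofReal (by positivity)]
  simp [VV, mul_comm]

lemma ell_meas (a : ℝ) : Measurable (fun p : Pt2 × Pt2 => ell a p.1 p.2) := by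
  unfold ell; fun_prop

lemma ell_meas' (a : ℝ) (x : Pt2) : Measurable (fun y : Pt2 => ell a x y) := by
  unfold ell; fun_prop

lemma ell_eq {a : ℝ} (ha : 0 < a) {x y : Pt2} (h : y ≠ x) :
    Real.log (dist x y) = Real.log a + ell a x y := by
  unfold ell
  rw [norm_smul, norm_inv, Real.norm_of_nonneg ha.le, ← dist_eq_norm,
    Real.log_mul (by positivity) (dist_pos.2 h.symm).ne', Real.log_inv]
  ring

lemma ell_sq {a c : ℝ} (ha : 0 < a) {z : Pt2} {Ω : Set Pt2} (hm : MeasurableSet Ω)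
    (hΩ : Ω ⊆ Metric.ball z (c * a)) {x : Pt2} (hx : x ∈ Ω) :
    IntegrableOn (fun y => ell a x y ^ 2) Ω ∧ ∫ y in Ω, ell a x y ^ 2 ≤ a ^ 2 * MM c := by
  set F : Pt2 → ℝ := (Metric.ball (0:Pt2) (2*c)).indicator (fun w => Real.log ‖w‖ ^ 2) with hF
  have hFi : Integrable F := logsq_integrable (2*c)
  have hi : Integrable (fun y => F (a⁻¹ • (x - y))) :=
    (hFi.comp_smul (inv_ne_zero ha.ne')).comp_sub_left x
  have hval : ∫ y, F (a⁻¹ • (x - y)) = a ^ 2 * MM c := by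
    rw [integral_sub_left_eq_self (fun y => F (a⁻¹ • y)) volume x, Measure.integral_comp_smul]
    simp [MM, hF]
  have heq : ∀ y ∈ Ω, F (a⁻¹ • (x - y)) = ell a x y ^ 2 := by
    intro y hy
    rw [hF, Set.indicator_of_mem]
    · rfl
    · rw [mem_ball_zero_iff, norm_smul, norm_inv, Real.norm_of_nonneg ha.le, ← dist_eq_norm]
      have h1 := hΩ hx
      have h2 := hΩ hy
      rw [Metric.mem_ball] at h1 h2
      have h3 := dist_triangle_right x y z
      rw [inv_mul_lt_iff₀ ha]; linarith
  have hF0 : ∀ w, 0 ≤ F w := fun w => Set.indicator_nonneg (fun _ _ => sq_nonneg _) w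
  refine ⟨hi.integrableOn.congr_fun heq hm, ?_⟩
  rw [← setIntegral_congr_fun hm heq, ← hval]
  exact setIntegral_le_integral hi (Filter.Eventually.of_forall fun y => hF0 _)

lemma norm_sq_Lp {Ω : Set Pt2} (u : Lp ℝ 2 (volume.restrict Ω)) : ‖u‖ ^ 2 = ∫ y in Ω, u y ^ 2 := by
  rw [← real_inner_self_eq_norm_sq, L2.inner_def]
  simp [sq]

/-- Cauchy-Schwarz in AM-GM form -/
lemma cs_aux {Ω : Set Pt2} {g : Pt2 → ℝ} (hg : AEStronglyMeasurable g (volume.restrict Ω))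
    (hg2 : IntegrableOn (fun y => g y ^ 2) Ω) {a M : ℝ} (ha : 0 < a)
    (hM : ∫ y in Ω, g y ^ 2 ≤ a ^ 2 * M) (u : Lp ℝ 2 (volume.restrict Ω)) :
    IntegrableOn (fun y => g y * u y) Ω ∧ ∫ y in Ω, |g y * u y| ≤ (M + 1) * a * ‖u‖ := by
  have hgL : MemLp g 2 (volume.restrict Ω) := (memLp_two_iff_integrable_sq hg).2 hg2
  have huL : MemLp u 2 (volume.restrict Ω) := Lp.memLp u
  have hu2 := huL.integrable_sq
  have hi : Integrable (fun y => g y * u y) (volume.restrict Ω) := hgL.integrable_mul huL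
  have hM0 : 0 ≤ M := by
    have : 0 ≤ ∫ y in Ω, g y ^ 2 := integral_nonneg fun y => sq_nonneg _
    have h2 : 0 ≤ a^2 * M := this.trans hM
    exact nonneg_of_mul_nonneg_right h2 (by positivity)
  refine ⟨hi, ?_⟩
  rcases eq_or_ne u 0 with rfl | hu
  · have : ∫ y in Ω, |g y * (0 : Lp ℝ 2 (volume.restrict Ω)) y| = ∫ y in Ω, (0:ℝ) := by
      apply integral_congr_ae
      filter_upwards [Lp.coeFn_zero ℝ 2 (volume.restrict Ω)] with y hy
      rw [hy]; simp
    rw [this]; simp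
  have hs : 0 < ‖u‖ := norm_pos_iff.2 hu
  set s := ‖u‖ with hsd
  have hle : ∫ y in Ω, |g y * u y| ≤ ∫ y in Ω, ((s / a) * g y ^ 2 + (a / s) * u y ^ 2) := by
    apply integral_mono hi.abs ((hg2.const_mul _).add (hu2.const_mul _))
    intro y
    change |g y * u y| ≤ (s / a) * g y ^ 2 + (a / s) * u y ^ 2
    rw [abs_mul]
    have h1 : (s / a) * g y ^ 2 + (a / s) * u y ^ 2 - |g y| * |u y| =
       (s/a) * ((|g y| - a / s * |u y| / 2) ^ 2 + 3 / 4 * (a/s) ^ 2 * |u y| ^ 2) := by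
      rw [← sq_abs (g y), ← sq_abs (u y)]
      field_simp
      ring
    have h2 : 0 ≤ (s/a) * ((|g y| - a / s * |u y| / 2) ^ 2 + 3 / 4 * (a/s) ^ 2 * |u y| ^ 2) := by positivity
    linarith
  refine hle.trans ?_
  rw [integral_add (hg2.const_mul _) (hu2.const_mul _), integral_const_mul, integral_const_mul,
    ← norm_sq_Lp u, ← hsd]
  have h1 : s / a * ∫ y in Ω, g y ^ 2 ≤ s / a * (a ^ 2 * M) := by gcongr
  have h2 : s / a * (a ^ 2 * M) + a / s * s ^ 2 = (M + 1) * a * s := by field_simp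
  linarith

lemma one_aux {a c : ℝ} (ha : 0 < a) (hc : 0 ≤ c) {z : Pt2} {Ω : Set Pt2}
    (hΩ : Ω ⊆ Metric.ball z (c * a)) (u : Lp ℝ 2 (volume.restrict Ω)) :
    IntegrableOn (fun y => u y) Ω ∧ ∫ y in Ω, |u y| ≤ (VV * c ^ 2 + 1) * a * ‖u‖ := by
  have hfin : volume Ω ≠ ⊤ := ((measure_mono hΩ).trans_lt measure_ball_lt_top).ne
  have h := cs_aux (Ω := Ω) (g := fun _ => 1) (M := VV * c ^ 2) aestronglyMeasurable_const
    (by simpa using integrableOn_const (C := (1:ℝ)) hfin) ha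
    (by
      have h1 : (volume Ω).toReal ≤ (volume (Metric.ball z (c*a))).toReal :=
        ENNReal.toReal_mono measure_ball_lt_top.ne (measure_mono hΩ)
      rw [vol_ball z (by positivity)] at h1
      simp [Measure.real]
      linarith) u
  simpa using h

lemma core {a c : ℝ} (ha : 0 < a) (hc : 0 ≤ c) {z : Pt2} {Ω : Set Pt2} (hm : MeasurableSet Ω)
    (hΩ : Ω ⊆ Metric.ball z (c * a)) (u : Lp ℝ 2 (volume.restrict Ω)) {x : Pt2} (hx : x ∈ Ω) :
    IntegrableOn (fun y => ell a x y * u y) Ω ∧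
    |∫ y in Ω, ell a x y * u y| ≤ (MM c + 1) * a * ‖u‖ ∧
    NOp Ω u x = -(1 / (2 * π)) * (Real.log a * (∫ y in Ω, u y) + ∫ y in Ω, ell a x y * u y) := by
  have hmeas := ell_meas' a x
  have h1 := ell_sq ha hm hΩ hx
  have h2 := cs_aux hmeas.aestronglyMeasurable h1.1 ha h1.2 u
  refine ⟨h2.1, (abs_integral_le_integral_abs).trans h2.2, ?_⟩
  have h3 := (one_aux ha hc hΩ u).1
  unfold NOp logKernel
  rw [← integral_const_mul, ← integral_add (h3.const_mul _) h2.1, ← integral_const_mul]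
  apply integral_congr_ae
  have : ∀ᵐ y ∂(volume.restrict Ω), y ≠ x := by
    apply ae_restrict_of_ae
    exact Measure.ae_ne volume x
  filter_upwards [this] with y hy
  rw [ell_eq ha hy]; ring

lemma upper {a c : ℝ} (ha : 0 < a) (hc : 0 ≤ c) {z : Pt2} {Ω : Set Pt2} (hm : MeasurableSet Ω)
    (hΩ : Ω ⊆ Metric.ball z (c * a)) (u : Lp ℝ 2 (volume.restrict Ω)) (hu : ∫ y in Ω, u y = 0) :
    quadForm Ω u ≤ (MM c + 1) * (VV * c ^ 2 + 1) * a ^ 2 * ‖u‖ ^ 2 := by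
  have hu1 := one_aux ha hc hΩ u
  have hMM := MM_nonneg c
  unfold quadForm
  refine (le_abs_self _).trans (abs_integral_le_integral_abs.trans ?_)
  have : ∫ x in Ω, |NOp Ω u x * u x| ≤ ∫ x in Ω, ((MM c + 1) * a * ‖u‖) * |u x| := by
    apply integral_mono_of_nonneg (Filter.Eventually.of_forall fun x => abs_nonneg _)
      (hu1.1.abs.const_mul _)
    filter_upwards [ae_restrict_mem hm] with x hx
    obtain ⟨-, h2, h3⟩ := core ha hc hm hΩ u hx
    rw [abs_mul]
    gcongr
    rw [h3, hu, mul_zero, zero_add, abs_mul]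
    have : |-(1 / (2 * π))| ≤ 1 := by
      rw [abs_neg, abs_of_pos (by positivity), div_le_one (by positivity)]
      linarith [Real.pi_gt_three]
    calc _ ≤ 1 * |∫ y in Ω, ell a x y * u y| := by gcongr
      _ ≤ _ := by linarith
  refine this.trans ?_
  rw [integral_const_mul]
  calc _ ≤ ((MM c + 1) * a * ‖u‖) * ((VV * c ^ 2 + 1) * a * ‖u‖) := by
        gcongr; exact hu1.2
    _ = _ := by ring

lemma exists_mean_zero {a c : ℝ} (ha : 0 < a) (hc : 0 ≤ c) {z : Pt2} {Ω : Set Pt2}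
    (hΩ : Ω ⊆ Metric.ball z (c * a)) (Ξ : Submodule ℝ (Lp ℝ 2 (volume.restrict Ω)))
    (h : 2 ≤ Module.finrank ℝ Ξ) : ∃ u ∈ Ξ, u ≠ 0 ∧ ∫ y in Ω, u y = 0 := by
  let I : Lp ℝ 2 (volume.restrict Ω) →ₗ[ℝ] ℝ :=
    { toFun := fun u => ∫ y in Ω, u y
      map_add' := fun u v => by
        rw [← integral_add (one_aux ha hc hΩ u).1 (one_aux ha hc hΩ v).1]
        exact integral_congr_ae (Lp.coeFn_add u v)
      map_smul' := fun t u => by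
        rw [RingHom.id_apply, smul_eq_mul, ← integral_const_mul]
        exact integral_congr_ae (Lp.coeFn_smul t u) }
  have : Module.Finite ℝ Ξ := Module.finite_of_finrank_pos (by omega)
  have hk : LinearMap.ker (I.domRestrict Ξ) ≠ ⊥ := LinearMap.ker_ne_bot_of_finrank_lt (by simp; omega)
  obtain ⟨v, hv, hv0⟩ := Submodule.exists_mem_ne_zero_of_ne_bot hk
  exact ⟨v, v.2, by simpa using hv0, by simpa [I] using hv⟩

lemma upper_set {a c : ℝ} (ha : 0 < a) (hc : 0 ≤ c) {z : Pt2} {Ω : Set Pt2} (hm : MeasurableSet Ω)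
    (hΩ : Ω ⊆ Metric.ball z (c * a)) (n : ℕ) (hn : 1 ≤ n) :
    ∀ r ∈ {r : ℝ | ∃ Ξ : Submodule ℝ (Lp ℝ 2 (volume.restrict Ω)),
      Module.finrank ℝ ↥Ξ = n + 1 ∧
      r = sInf {q : ℝ | ∃ u ∈ Ξ, u ≠ 0 ∧ q = quadForm Ω u / ‖u‖ ^ 2}},
      r ≤ (MM c + 1) * (VV * c ^ 2 + 1) * a ^ 2 := by
  rintro r ⟨Ξ, hΞ, rfl⟩
  have hMM := MM_nonneg c
  have hVV := VV_pos
  obtain ⟨u, huΞ, hu0, hu⟩ := exists_mean_zero ha hc hΩ Ξ (by omega)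
  by_cases hb : BddBelow {q : ℝ | ∃ u ∈ Ξ, u ≠ 0 ∧ q = quadForm Ω u / ‖u‖ ^ 2}
  · refine (csInf_le hb ⟨u, huΞ, hu0, rfl⟩).trans ?_
    rw [div_le_iff₀ (by have := norm_pos_iff.2 hu0; positivity)]
    exact upper ha hc hm hΩ u hu
  · rw [Real.sInf_of_not_bddBelow hb]; positivity

lemma int_step {Ω : Set Pt2} {N : ℕ} {B : Fin N → Set Pt2} {m : ℝ}
    (hB : ∀ i, MeasurableSet (B i)) (hBΩ : ∀ i, B i ⊆ Ω)
    (hm : ∀ i, (volume (B i)).toReal = m) (hfin : volume Ω ≠ ⊤) (k : Fin N → ℝ) :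
    IntegrableOn (fun x => ∑ i, (B i).indicator (fun _ => (1:ℝ)) x * k i) Ω ∧
    ∫ x in Ω, ∑ i, (B i).indicator (fun _ => (1:ℝ)) x * k i = m * ∑ i, k i := by
  have hi : ∀ i, Integrable (fun x => (B i).indicator (fun _ => (1:ℝ)) x * k i) (volume.restrict Ω) := by
    intro i
    exact ((integrableOn_const (C := (1:ℝ)) hfin).indicator (hB i)).mul_const _
  refine ⟨integrable_finsetSum _ fun i _ => hi i, ?_⟩
  rw [integral_finsetSum _ fun i _ => hi i, Finset.mul_sum]
  refine Finset.sum_congr rfl fun i _ => ?_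
  rw [integral_mul_const, setIntegral_indicator (hB i), Set.inter_eq_self_of_subset_right (hBΩ i)]
  simp [Measure.real, hm]

lemma ind_sum {N : ℕ} {B : Fin N → Set Pt2} (hd : ∀ i j, i ≠ j → Disjoint (B i) (B j))
    (k : Fin N → ℝ) {x : Pt2} {i : Fin N} (hx : x ∈ B i) :
    ∑ j, (B j).indicator (fun _ => (1:ℝ)) x * k j = k i := by
  rw [Finset.sum_eq_single i]
  · simp [hx]
  · intro j _ hj
    have : x ∉ B j := fun h => Set.disjoint_left.1 (hd j i hj) h hx
    simp [this]
  · simp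

lemma ind_sum_zero {N : ℕ} {B : Fin N → Set Pt2}
    (k : Fin N → ℝ) {x : Pt2} (hx : ∀ i, x ∉ B i) :
    ∑ j, (B j).indicator (fun _ => (1:ℝ)) x * k j = 0 :=
  Finset.sum_eq_zero fun j _ => by simp [hx j]

lemma ell_integrable {a c : ℝ} (ha : 0 < a) {z : Pt2} {Ω : Set Pt2} (hm : MeasurableSet Ω)
    (hΩ : Ω ⊆ Metric.ball z (c * a)) {x : Pt2} (hx : x ∈ Ω) :
    IntegrableOn (fun y => ell a x y) Ω := by
  have hfin : volume Ω ≠ ⊤ := ((measure_mono hΩ).trans_lt measure_ball_lt_top).ne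
  have : IsFiniteMeasure (volume.restrict Ω) := ⟨by simpa using hfin.lt_top⟩
  have h1 := ell_sq ha hm hΩ hx
  exact ((memLp_two_iff_integrable_sq (ell_meas' a x).aestronglyMeasurable).2 h1.1).integrable
    (by norm_num)

lemma alg_aux {N : ℕ} (t I : Fin N → ℝ) {m K L : ℝ} (hm : 0 ≤ m) (hK : 0 ≤ K) (i : Fin N)
    (hi : I i ≤ m * (-L)) (hj : ∀ j, j ≠ i → |I j| ≤ m * K) :
    m * (L * t i ^ 2 - K * |t i| * ∑ j, |t j|) ≤ -(∑ j, t j * I j) * t i := by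
  have h1 : ∀ j, (if j = i then m * (L * t i ^ 2) else 0) - m * (K * |t i| * |t j|) ≤ -(t j * I j) * t i := by
    intro j
    split_ifs with h
    · subst h
      have : 0 ≤ m * (K * |t j| * |t j|) := by positivity
      nlinarith [sq_nonneg (t j)]
    · have h2 : (t j * I j) * t i ≤ |t j| * |I j| * |t i| := by
        rw [← abs_mul, ← abs_mul]; exact le_abs_self _
      have h3 : |t j| * |I j| * |t i| ≤ |t j| * (m * K) * |t i| := by
        gcongr; exact hj j h
      linarith
  have h2 := Finset.sum_le_sum fun j (_ : j ∈ Finset.univ) => h1 j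
  rw [Finset.sum_sub_distrib, ← Finset.sum_mul, Finset.sum_neg_distrib, ← Finset.mul_sum,
    ← Finset.mul_sum] at h2
  simp at h2
  linarith

lemma lower_quad {a c : ℝ} (ha : 0 < a) (ha1 : a < 1) (hc : 0 ≤ c) {z : Pt2} {Ω : Set Pt2}
    (hm : MeasurableSet Ω) (hΩ : Ω ⊆ Metric.ball z (c * a)) {N : ℕ} {B : Fin N → Set Pt2} {m K L : ℝ}
    (hB : ∀ i, MeasurableSet (B i)) (hBΩ : ∀ i, B i ⊆ Ω)
    (hd : ∀ i j, i ≠ j → Disjoint (B i) (B j))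
    (hvol : ∀ i, (volume (B i)).toReal = m) (hm0 : 0 < m) (hK : 0 ≤ K) (hL : K * N + 1 ≤ L)
    (hdiag : ∀ i, ∀ x ∈ B i, ∀ y ∈ B i, y ≠ x → ell a x y ≤ -L)
    (hoff : ∀ i j, i ≠ j → ∀ x ∈ B i, ∀ y ∈ B j, |ell a x y| ≤ K)
    (t : Fin N → ℝ) (u : Lp ℝ 2 (volume.restrict Ω))
    (hu : u =ᵐ[volume.restrict Ω] fun x => ∑ i, (B i).indicator (fun _ => (1:ℝ)) x * t i) :
    ‖u‖ ^ 2 = m * ∑ i, t i ^ 2 ∧ m / (2 * π) * ‖u‖ ^ 2 ≤ quadForm Ω u := by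
  have hfin : volume Ω ≠ ⊤ := ((measure_mono hΩ).trans_lt measure_ball_lt_top).ne
  have hnorm : ‖u‖ ^ 2 = m * ∑ i, t i ^ 2 := by
    rw [norm_sq_Lp, ← (int_step hB hBΩ hvol hfin (fun i => t i ^ 2)).2]
    apply integral_congr_ae
    filter_upwards [hu] with x hx
    rw [hx]
    by_cases h : ∃ i, x ∈ B i
    · obtain ⟨i, hi⟩ := h
      rw [ind_sum hd _ hi, ind_sum hd _ hi]
    · push Not at h
      rw [ind_sum_zero _ h, ind_sum_zero _ h]; simp
  refine ⟨hnorm, ?_⟩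
  set J : Pt2 → ℝ := fun x => ∫ y in Ω, ell a x y * u y with hJ
  set S := ∫ y in Ω, u y with hS
  have hui := (one_aux ha hc hΩ u).1
  have hJm : AEStronglyMeasurable J (volume.restrict Ω) := by
    apply StronglyMeasurable.aestronglyMeasurable
    apply StronglyMeasurable.integral_prod_right (f := fun x y => ell a x y * u y)
    exact (ell_meas a).stronglyMeasurable.mul ((Lp.stronglyMeasurable u).comp_measurable measurable_snd)
  have hJi : Integrable (fun x => -J x * u x) (volume.restrict Ω) := by
    refine Integrable.bdd_mul (c := (MM c + 1) * a * ‖u‖) hui hJm.neg ?_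
    filter_upwards [ae_restrict_mem hm] with x hx
    rw [norm_neg, Real.norm_eq_abs]
    exact (core ha hc hm hΩ u hx).2.1
  have hq : quadForm Ω u = 1 / (2 * π) * (-Real.log a * S ^ 2 + ∫ x in Ω, -J x * u x) := by
    have : -Real.log a * S ^ 2 = ∫ x in Ω, (-Real.log a * S) * u x := by
      rw [integral_const_mul]; ring
    rw [this, ← integral_add (hui.const_mul _) hJi, ← integral_const_mul]
    unfold quadForm
    apply integral_congr_ae
    filter_upwards [ae_restrict_mem hm] with x hx
    rw [(core ha hc hm hΩ u hx).2.2]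
    ring
  have hJsum : ∀ x ∈ Ω, J x = ∑ j, t j * ∫ y in B j, ell a x y := by
    intro x hx
    have hei := ell_integrable ha hm hΩ hx
    have : J x = ∫ y in Ω, ∑ j, t j * (B j).indicator (fun y => ell a x y) y := by
      apply integral_congr_ae
      filter_upwards [hu] with y hy
      rw [hy, Finset.mul_sum]
      refine Finset.sum_congr rfl fun j _ => ?_
      by_cases h : y ∈ B j <;> simp [h, mul_comm]
    rw [this, integral_finsetSum _ fun j _ => (hei.indicator (hB j)).const_mul _]
    refine Finset.sum_congr rfl fun j _ => ?_
    rw [integral_const_mul, setIntegral_indicator (hB j), Set.inter_eq_self_of_subset_right (hBΩ j)]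
  have hBfin : ∀ i, volume (B i) ≠ ⊤ := fun i => ((measure_mono (hBΩ i)).trans_lt hfin.lt_top).ne
  have hh := int_step hB hBΩ hvol hfin (fun i => m * (L * t i ^ 2 - K * |t i| * ∑ j, |t j|))
  have hJlow : m * ∑ i, m * (L * t i ^ 2 - K * |t i| * ∑ j, |t j|) ≤ ∫ x in Ω, -J x * u x := by
    rw [← hh.2]
    apply integral_mono_ae hh.1 hJi
    filter_upwards [hu, ae_restrict_mem hm] with x hx hxΩ
    rw [hx]
    by_cases h : ∃ i, x ∈ B i
    · obtain ⟨i, hi⟩ := h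
      rw [ind_sum hd _ hi, ind_sum hd _ hi, hJsum x hxΩ]
      have hei := ell_integrable ha hm hΩ hxΩ
      apply alg_aux t _ hm0.le hK i
      · have : ∫ y in B i, ell a x y ≤ ∫ y in B i, (-L) := by
          apply integral_mono_ae (hei.mono_set (hBΩ i)) (integrableOn_const (hBfin i))
          have hne : ∀ᵐ y ∂(volume.restrict (B i)), y ≠ x :=
            ae_restrict_of_ae (Measure.ae_ne volume x)
          filter_upwards [hne, ae_restrict_mem (hB i)] with y hy hyB
          exact hdiag i x hi y hyB hy
        simpa [Measure.real, hvol] using this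
      · intro j hj
        have := norm_setIntegral_le_of_norm_le_const (μ := volume) (s := B j) (C := K)
          (f := fun y => ell a x y) (hBfin j).lt_top
          (fun y hy => hoff i j hj.symm x hi y hy)
        simpa [Measure.real, hvol, mul_comm] using this
    · push Not at h
      rw [ind_sum_zero _ h, ind_sum_zero _ h]; simp
  have hT : (∑ j, |t j|) ^ 2 ≤ N * ∑ j, t j ^ 2 := by
    have := sq_sum_le_card_mul_sum_sq (s := Finset.univ) (f := fun j => |t j|)
    simpa using this
  have hsum : ∑ i, m * (L * t i ^ 2 - K * |t i| * ∑ j, |t j|)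
      = m * (L * ∑ i, t i ^ 2 - K * (∑ j, |t j|) ^ 2) := by
    rw [← Finset.mul_sum, Finset.sum_sub_distrib, ← Finset.mul_sum, ← Finset.sum_mul, ← Finset.mul_sum]
    ring
  have hS0 : 0 ≤ ∑ i, t i ^ 2 := Finset.sum_nonneg fun i _ => sq_nonneg _
  have hfinal : m * (m * ∑ i, t i ^ 2) ≤ ∫ x in Ω, -J x * u x := by
    refine le_trans ?_ hJlow
    rw [hsum]
    gcongr
    have := mul_le_mul_of_nonneg_left hT hK
    nlinarith [mul_le_mul_of_nonneg_right hL hS0]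
  have hlog : 0 ≤ -Real.log a * S ^ 2 :=
    mul_nonneg (by linarith [Real.log_neg ha ha1]) (sq_nonneg _)
  rw [hq, hnorm]
  have : m / (2 * π) * (m * ∑ i, t i ^ 2) = 1 / (2 * π) * (m * (m * ∑ i, t i ^ 2)) := by ring
  rw [this]
  gcongr
  linarith

lemma lower_space {a c : ℝ} (ha : 0 < a) (ha1 : a < 1) (hc : 0 ≤ c) {z : Pt2} {Ω : Set Pt2}
    (hm : MeasurableSet Ω) (hΩ : Ω ⊆ Metric.ball z (c * a)) {N : ℕ} {B : Fin N → Set Pt2} {m K L : ℝ}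
    (hB : ∀ i, MeasurableSet (B i)) (hBΩ : ∀ i, B i ⊆ Ω)
    (hd : ∀ i j, i ≠ j → Disjoint (B i) (B j))
    (hvol : ∀ i, (volume (B i)).toReal = m) (hm0 : 0 < m) (hK : 0 ≤ K) (hL : K * N + 1 ≤ L)
    (hdiag : ∀ i, ∀ x ∈ B i, ∀ y ∈ B i, y ≠ x → ell a x y ≤ -L)
    (hoff : ∀ i j, i ≠ j → ∀ x ∈ B i, ∀ y ∈ B j, |ell a x y| ≤ K) :
    ∃ Ξ : Submodule ℝ (Lp ℝ 2 (volume.restrict Ω)), Module.finrank ℝ Ξ = N ∧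
      ∀ u ∈ Ξ, m / (2 * π) * ‖u‖ ^ 2 ≤ quadForm Ω u := by
  have hfin : volume Ω ≠ ⊤ := ((measure_mono hΩ).trans_lt measure_ball_lt_top).ne
  have hBf : ∀ i, (volume.restrict Ω) (B i) ≠ ⊤ := fun i =>
    ((Measure.restrict_apply_le _ _).trans_lt ((measure_mono (hBΩ i)).trans_lt hfin.lt_top)).ne
  let φ : Fin N → Lp ℝ 2 (volume.restrict Ω) := fun i => indicatorConstLp 2 (hB i) (hBf i) (1:ℝ)
  have hae : ∀ t : Fin N → ℝ, (∑ i, t i • φ i : Lp ℝ 2 (volume.restrict Ω)) =ᵐ[volume.restrict Ω]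
      fun x => ∑ i, (B i).indicator (fun _ => (1:ℝ)) x * t i := by
    intro t
    have h1 := Lp.coeFn_fun_finsetSum Finset.univ (fun i => t i • φ i)
    have h2 : ∀ᵐ x ∂(volume.restrict Ω), ∀ i, (t i • φ i : Lp ℝ 2 (volume.restrict Ω)) x
        = (B i).indicator (fun _ => (1:ℝ)) x * t i := by
      rw [ae_all_iff]
      intro i
      filter_upwards [Lp.coeFn_smul (t i) (φ i),
        indicatorConstLp_coeFn (p := 2) (hs := hB i) (hμs := hBf i) (c := (1:ℝ))] with x hx hx2
      rw [hx, Pi.smul_apply, hx2, smul_eq_mul, mul_comm]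
    filter_upwards [h1, h2] with x hx hx2
    rw [hx]
    exact Finset.sum_congr rfl fun i _ => hx2 i
  have hquad := fun t => lower_quad ha ha1 hc hm hΩ hB hBΩ hd hvol hm0 hK hL hdiag hoff t _ (hae t)
  have hli : LinearIndependent ℝ φ := by
    rw [Fintype.linearIndependent_iff]
    intro t ht i
    have h := (hquad t).1
    rw [ht] at h
    simp only [norm_zero, ne_eq, OfNat.ofNat_ne_zero, not_false_eq_true, zero_pow] at h
    have h2 : ∑ i, t i ^ 2 = 0 := by
      rcases mul_eq_zero.1 h.symm with h | h
      · exact absurd h hm0.ne'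
      · exact h
    rw [Finset.sum_eq_zero_iff_of_nonneg (fun i _ => sq_nonneg _)] at h2
    exact pow_eq_zero_iff (two_ne_zero) |>.1 (h2 i (Finset.mem_univ _))
  refine ⟨Submodule.span ℝ (Set.range φ), by simpa using finrank_span_eq_card hli, ?_⟩
  intro u hu
  obtain ⟨t, rfl⟩ := (Submodule.mem_span_range_iff_exists_fun ℝ).1 hu
  exact (hquad t).2

lemma geom {a c₁ : ℝ} (ha : 0 < a) (hc₁ : 0 < c₁) (n : ℕ) (z : Pt2) {ε : ℝ}
    (hε : 0 < ε) (hε2 : ε ≤ c₁ / (4 * (n + 1))) :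
    ∃ p : Fin (n + 1) → Pt2,
      (∀ i, Metric.ball (p i) (ε * a) ⊆ Metric.ball z (c₁ * a)) ∧
      (∀ i j, i ≠ j → c₁ / (n + 1) * a ≤ dist (p i) (p j)) := by
  let e : Pt2 := EuclideanSpace.single 0 1
  have he : ‖e‖ = 1 := by simp [e]
  refine ⟨fun i => z + ((i : ℝ) / (n + 1) * (c₁ * a)) • e, ?_, ?_⟩
  · intro i
    apply Metric.ball_subset_ball'
    rw [dist_eq_norm, add_sub_cancel_left, norm_smul, he, Real.norm_of_nonneg (by positivity)]
    have hi : (i : ℝ) ≤ n := by exact_mod_cast Nat.lt_succ_iff.1 i.2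
    have h1 : ε * a ≤ c₁ / (4 * (n + 1)) * a := by gcongr
    have h2 : (i : ℝ) / (n + 1) * (c₁ * a) ≤ n / (n + 1) * (c₁ * a) := by gcongr
    have h3 : c₁ / (4 * (n + 1)) * a + n / (n + 1) * (c₁ * a) + 3 / 4 / (n+1) * (c₁ * a) = c₁ * a := by
      field_simp; ring
    have h4 : 0 ≤ 3 / 4 / ((n:ℝ)+1) * (c₁ * a) := by positivity
    linarith
  · intro i j hij
    rw [dist_eq_norm, add_sub_add_left_eq_sub, ← sub_smul, norm_smul, he, mul_one, ← sub_mul,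
      ← sub_div, norm_mul, norm_div, Real.norm_of_nonneg (by positivity : 0 ≤ c₁ * a),
      Real.norm_of_nonneg (by positivity : (0:ℝ) ≤ n + 1)]
    have : (1:ℝ) ≤ ‖(i:ℝ) - j‖ := by
      have h : ((i:ℕ):ℤ) - (j:ℕ) ≠ 0 := by
        intro h; apply hij; ext; omega
      have := Int.one_le_abs h
      rw [Real.norm_eq_abs]
      exact_mod_cast this
    calc c₁ / (n + 1) * a = 1 / (n + 1) * (c₁ * a) := by ring
      _ ≤ _ := by gcongr

lemma lower_full (c₁ : ℝ) (hc₁ : 0 < c₁) (n : ℕ) :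
    ∃ k : ℝ, 0 < k ∧ ∀ (a c : ℝ) (_ : 0 < a) (_ : a < 1) (_ : 0 ≤ c) (z₁ z : Pt2) (Ω : Set Pt2)
      (_ : MeasurableSet Ω) (_ : Metric.ball z₁ (c₁ * a) ⊆ Ω) (_ : Ω ⊆ Metric.ball z (c * a)),
      ∃ Ξ : Submodule ℝ (Lp ℝ 2 (volume.restrict Ω)), Module.finrank ℝ Ξ = n + 1 ∧
        ∀ u ∈ Ξ, k * a ^ 2 * ‖u‖ ^ 2 ≤ quadForm Ω u := by
  set δ : ℝ := c₁ / (2 * (n + 1)) with hδ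
  have hδ0 : 0 < δ := by positivity
  set K : ℝ := |Real.log δ| + |Real.log (2 * c₁)| with hKd
  have hK : 0 ≤ K := by positivity
  set L : ℝ := K * (n + 1 : ℕ) + 1 with hL
  set ε : ℝ := min (c₁ / (4 * (n + 1))) (Real.exp (-L) / 2) with hεd
  have hε : 0 < ε := by positivity
  have hε1 : ε ≤ c₁ / (4 * (n + 1)) := min_le_left _ _
  have hε2 : ε ≤ Real.exp (-L) / 2 := min_le_right _ _
  have hεδ : 2 * ε ≤ δ := by
    have : 2 * (c₁ / (4 * ((n:ℝ) + 1))) = δ := by rw [hδ]; field_simp; ring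
    linarith
  have hVV := VV_pos
  refine ⟨VV * ε ^ 2 / (2 * π), by positivity, ?_⟩
  intro a c ha ha1 hc z₁ z Ω hm h1 h2
  obtain ⟨p, hp, hpd⟩ := geom ha hc₁ n z₁ hε hε1
  have hsep : ∀ i j, i ≠ j → ∀ x ∈ Metric.ball (p i) (ε * a), ∀ y ∈ Metric.ball (p j) (ε * a),
      δ * a ≤ dist x y := by
    intro i j hij x hx y hy
    rw [Metric.mem_ball] at hx hy
    have h3 := hpd i j hij
    have h4 : dist (p i) (p j) ≤ dist x (p i) + dist x y + dist y (p j) := by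
      rw [dist_comm x (p i)]; exact dist_triangle4 _ _ _ _
    have h5 : c₁ / (n + 1) * a = 2 * δ * a := by rw [hδ]; field_simp
    have h6 : 2 * ε * a ≤ δ * a := by gcongr
    linarith
  have hell : ∀ x y : Pt2, ell a x y = Real.log (dist x y / a) := by
    intro x y
    unfold ell
    rw [norm_smul, norm_inv, Real.norm_of_nonneg ha.le, ← dist_eq_norm, inv_mul_eq_div]
  obtain ⟨Ξ, hΞ, hΞ2⟩ := lower_space (N := n + 1) (B := fun i => Metric.ball (p i) (ε * a))
    (m := VV * (ε * a) ^ 2) (K := K) (L := L) ha ha1 hc hm h2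
    (fun i => measurableSet_ball) (fun i => (hp i).trans h1) (by
      intro i j hij
      rw [Set.disjoint_left]
      intro x hx hy
      have := hsep i j hij x hx x hy
      rw [dist_self] at this
      have : 0 < δ * a := by positivity
      linarith)
    (fun i => vol_ball _ (by positivity)) (by positivity) hK le_rfl (by
      intro i x hx y hy hxy
      rw [hell]
      have hpos : 0 < dist x y := dist_pos.2 hxy.symm
      rw [Real.log_le_iff_le_exp (by positivity), div_le_iff₀ ha]
      rw [Metric.mem_ball] at hx hy
      have := dist_triangle_right x y (p i)
      have h3 : ε * a ≤ Real.exp (-L) / 2 * a := by gcongr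
      linarith)
    (by
      intro i j hij x hx y hy
      rw [hell]
      have h3 := hsep i j hij x hx y hy
      have h3' : δ ≤ dist x y / a := by rwa [le_div_iff₀ ha]
      have h4 : dist x y / a ≤ 2 * c₁ := by
        rw [div_le_iff₀ ha]
        have hx' := hp i hx
        have hy' := hp j hy
        rw [Metric.mem_ball] at hx' hy'
        have := dist_triangle_right x y z₁
        linarith
      have h5 := Real.log_le_log hδ0 h3'
      have h6 := Real.log_le_log (hδ0.trans_le h3') h4
      rw [abs_le]
      constructor
      · linarith [neg_abs_le (Real.log δ), abs_nonneg (Real.log (2 * c₁))]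
      · linarith [le_abs_self (Real.log (2 * c₁)), abs_nonneg (Real.log δ)])
  refine ⟨Ξ, hΞ, fun u hu => ?_⟩
  have := hΞ2 u hu
  calc _ = VV * (ε * a) ^ 2 / (2 * π) * ‖u‖ ^ 2 := by ring
    _ ≤ _ := this

/-- For `n ≥ 1`, the `n`-th eigenvalue of the logarithmic potential operator on a sandwiched
domain is comparable to `a²`. -/
theorem eigen2_higher_scaling (c₁ c₂ : ℝ) (hc₁ : 0 < c₁) (hc₁₂ : c₁ ≤ c₂)
    (n : ℕ) (hn : 1 ≤ n) :
    ∃ (cₙ Cₙ a₀ : ℝ), 0 < cₙ ∧ cₙ ≤ Cₙ ∧ 0 < a₀ ∧ a₀ < 1 ∧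
      ∀ a : ℝ, 0 < a → a < a₀ →
        ∀ Ω : Set Pt2, Bornology.IsBounded Ω → MeasurableSet Ω →
          Sandwich c₁ c₂ a Ω →
            cₙ * a ^ 2 ≤ eigen2 Ω n ∧ eigen2 Ω n ≤ Cₙ * a ^ 2 := by
  obtain ⟨k, hk, hlow⟩ := lower_full c₁ hc₁ n
  have hc₂ : 0 ≤ c₂ := hc₁.le.trans hc₁₂
  refine ⟨k, max k ((MM c₂ + 1) * (VV * c₂ ^ 2 + 1)), 1 / 2, hk, le_max_left _ _,
    by norm_num, by norm_num, ?_⟩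
  intro a ha ha2 Ω _ hm ⟨z₁, z₂, ρ₁, ρ₂, h1, _, _, h4, h5, h6⟩
  have hΩ : Ω ⊆ Metric.ball z₂ (c₂ * a) := h6.trans (Metric.ball_subset_ball h4)
  have hΩ1 : Metric.ball z₁ (c₁ * a) ⊆ Ω := (Metric.ball_subset_ball h1).trans h5
  have hup := upper_set ha hc₂ hm hΩ n hn
  have hMM := MM_nonneg c₂
  have hVV := VV_pos
  constructor
  · obtain ⟨Ξ, hΞ, hq⟩ := hlow a c₂ ha (by linarith) hc₂ z₁ z₂ Ω hm hΩ1 hΩ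
    refine le_trans ?_ (le_csSup ⟨_, hup⟩ ⟨Ξ, hΞ, rfl⟩)
    obtain ⟨v, hv, hv0, -⟩ := exists_mean_zero ha hc₂ hΩ Ξ (by omega)
    refine le_csInf ⟨_, v, hv, hv0, rfl⟩ ?_
    rintro q ⟨u, hu, hu0, rfl⟩
    have := norm_pos_iff.2 hu0
    rw [le_div_iff₀ (by positivity)]
    exact hq u hu
  · refine Real.sSup_le (fun r hr => (hup r hr).trans ?_) (by positivity)
    gcongr
    exact le_max_right _ _

end
end

section
/- Fix an integer j ≥ 2. There exist constants 0 < c ≤ C and a₀ ∈ (0,1) such that for every a ∈ (0, a₀): the function Ψ_a has at least j zeros in (0, ∞), and its j-th smallest positive zero μ_j(a) satisfies c · |log a|⁻¹ ≤ √(2π) · |J₁(μ_j(a))| / ( ∫₀^{μ_j(a)} J₀(r)² · r dr )^{1/2} ≤ C · |log a|⁻¹. (This quantity equals a⁻¹ · |∫_{D_a} v_{0,j}|, where v_{0,j} is the L²-normalized radial eigenfunction of the logarithmic potential operator on the disc of radius a associated with the root μ_j(a).) -/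
open Real

noncomputable section

/-- Bessel function of the first kind of order 0, via its power series. -/
def J0 (x : ℝ) : ℝ := ∑' k : ℕ, (-1 : ℝ) ^ k * (x / 2) ^ (2 * k) / ((k.factorial : ℝ)) ^ 2

/-- Bessel function of the first kind of order 1, via its power series. -/
def J1 (x : ℝ) : ℝ :=
  ∑' k : ℕ, (-1 : ℝ) ^ k * (x / 2) ^ (2 * k + 1) / ((k.factorial : ℝ) * ((k + 1).factorial : ℝ))

/-- The transcendental function `Ψ_a(x) = J₀(x) + 2 log(a) x J₁(x)`. -/
def Psi (a x : ℝ) : ℝ := J0 x + 2 * Real.log a * x * J1 x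

theorem aux_d (c : ℝ) (k : ℕ) (y : ℝ) :
    HasDerivAt (fun x : ℝ => c / (k + 1) * (x / 2) ^ (2 * k + 2))
      (c * (y / 2) ^ (2 * k + 1)) y := by
  have h1 : HasDerivAt (fun x : ℝ => x / 2) (1 / 2) y := (hasDerivAt_id y).div_const 2
  have h := (h1.fun_pow (2 * k + 2)).const_mul (c / (k + 1))
  refine h.congr_deriv ?_
  have : (k : ℝ) + 1 ≠ 0 := by positivity
  rw [show 2 * k + 2 - 1 = 2 * k + 1 from by omega]
  push_cast
  field_simp

theorem aux_b (c : ℝ) (k : ℕ) (y R : ℝ) (hc : |c| ≤ 2 / (k.factorial : ℝ))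
    (hy : y ∈ Metric.ball (0 : ℝ) R) :
    ‖c * (y / 2) ^ (2 * k + 1)‖ ≤ R * (2 * ((R ^ 2) ^ k / (k.factorial : ℝ))) := by
  rw [Metric.mem_ball, dist_zero_right, Real.norm_eq_abs] at hy
  rw [Real.norm_eq_abs, abs_mul, abs_pow]
  have h1 : |y / 2| ≤ R := by
    rw [abs_div, abs_two]; linarith [abs_nonneg y]
  have h2 : |y / 2| ^ (2 * k + 1) ≤ R ^ (2 * k + 1) := pow_le_pow_left₀ (abs_nonneg _) h1 _
  have h3 : |c| * |y / 2| ^ (2 * k + 1) ≤ (2 / (k.factorial : ℝ)) * R ^ (2 * k + 1) :=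
    mul_le_mul hc h2 (by positivity) (by positivity)
  have h4 : R ^ (2 * k + 1) = (R ^ 2) ^ k * R := by rw [pow_succ, pow_mul]
  rw [h4] at h3
  refine h3.trans (le_of_eq ?_)
  ring

theorem bessel_aux (c : ℕ → ℝ) (hc : ∀ k, |c k| ≤ 2 / (k.factorial : ℝ)) (x : ℝ) :
    (Summable fun k : ℕ => c k / (k + 1) * (x / 2) ^ (2 * k + 2)) ∧
    HasDerivAt (fun x : ℝ => ∑' k : ℕ, c k / (k + 1) * (x / 2) ^ (2 * k + 2))
      (∑' k : ℕ, c k * (x / 2) ^ (2 * k + 1)) x := by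
  obtain ⟨R, hR⟩ : ∃ R : ℝ, R = |x| + 1 := ⟨_, rfl⟩
  have hR0 : 0 < R := by rw [hR]; positivity
  have hu : Summable fun k : ℕ => R * (2 * ((R ^ 2) ^ k / (k.factorial : ℝ))) :=
    ((Real.summable_pow_div_factorial (R ^ 2)).mul_left 2).mul_left R
  have hd : ∀ (k : ℕ) (y : ℝ), y ∈ Metric.ball (0 : ℝ) R →
      HasDerivAt (fun x : ℝ => c k / (k + 1) * (x / 2) ^ (2 * k + 2))
        (c k * (y / 2) ^ (2 * k + 1)) y := by
    intro k y _
    exact aux_d (c k) k y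
  have hb : ∀ (k : ℕ) (y : ℝ), y ∈ Metric.ball (0 : ℝ) R →
      ‖c k * (y / 2) ^ (2 * k + 1)‖ ≤ R * (2 * ((R ^ 2) ^ k / (k.factorial : ℝ))) := by
    intro k y hy
    exact aux_b (c k) k y R (hc k) hy
  have h0 : (0 : ℝ) ∈ Metric.ball (0 : ℝ) R := by simpa using hR0
  have hx : x ∈ Metric.ball (0 : ℝ) R := by
    rw [Metric.mem_ball, dist_zero_right, Real.norm_eq_abs]; linarith
  have hs0 : Summable fun k : ℕ => c k / (k + 1) * ((0 : ℝ) / 2) ^ (2 * k + 2) := by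
    simp
  have hp : IsPreconnected (Metric.ball (0 : ℝ) R) := (convex_ball 0 R).isPreconnected
  exact ⟨summable_of_summable_hasDerivAt_of_isPreconnected
      (g := fun (k : ℕ) (x : ℝ) => c k / (k + 1) * (x / 2) ^ (2 * k + 2))
      (g' := fun (k : ℕ) (x : ℝ) => c k * (x / 2) ^ (2 * k + 1)) (y₀ := 0) hu Metric.isOpen_ball hp hd hb h0 hs0 hx,
    hasDerivAt_tsum_of_isPreconnected hu Metric.isOpen_ball hp hd hb h0 hs0 hx⟩

theorem J0_eq (x : ℝ) : J0 x = 1 - ∑' k : ℕ,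
    ((-1 : ℝ) ^ k / ((k.factorial : ℝ) * ((k + 1).factorial : ℝ))) / (k + 1) *
      (x / 2) ^ (2 * k + 2) := by
  have hc : ∀ k : ℕ, |(-1 : ℝ) ^ k / ((k.factorial : ℝ) * ((k + 1).factorial : ℝ))| ≤
      2 / (k.factorial : ℝ) := by
    intro k
    have h1 : (1 : ℝ) ≤ ((k + 1).factorial : ℝ) := by exact_mod_cast Nat.factorial_pos (k + 1)
    have h2 : (0 : ℝ) < (k.factorial : ℝ) := by exact_mod_cast Nat.factorial_pos k
    rw [abs_div, abs_pow, abs_neg, abs_one, one_pow, abs_of_pos (by positivity)]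
    rw [div_le_div_iff₀ (by positivity) h2]
    nlinarith
  have hs := (bessel_aux _ hc x).1
  have he : ∀ k : ℕ, (-1 : ℝ) ^ (k + 1) * (x / 2) ^ (2 * (k + 1)) / (((k + 1).factorial : ℝ)) ^ 2
      = - (((-1 : ℝ) ^ k / ((k.factorial : ℝ) * ((k + 1).factorial : ℝ))) / (k + 1) *
      (x / 2) ^ (2 * k + 2)) := by
    intro k
    have h2 : (k.factorial : ℝ) ≠ 0 := by exact_mod_cast (Nat.factorial_pos k).ne'
    have : (k : ℝ) + 1 ≠ 0 := by positivity
    rw [Nat.factorial_succ]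
    push_cast
    field_simp
    ring
  have hs' : Summable fun k : ℕ => (-1 : ℝ) ^ k * (x / 2) ^ (2 * k) / ((k.factorial : ℝ)) ^ 2 := by
    rw [← summable_nat_add_iff 1]
    simp_rw [he]
    exact hs.neg
  unfold J0
  rw [hs'.tsum_eq_zero_add]
  simp_rw [he]
  rw [tsum_neg]
  simp [sub_eq_add_neg]

theorem hasDerivAt_J0 (x : ℝ) : HasDerivAt J0 (- J1 x) x := by
  have hc : ∀ k : ℕ, |(-1 : ℝ) ^ k / ((k.factorial : ℝ) * ((k + 1).factorial : ℝ))| ≤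
      2 / (k.factorial : ℝ) := by
    intro k
    have h1 : (1 : ℝ) ≤ ((k + 1).factorial : ℝ) := by exact_mod_cast Nat.factorial_pos (k + 1)
    have h2 : (0 : ℝ) < (k.factorial : ℝ) := by exact_mod_cast Nat.factorial_pos k
    rw [abs_div, abs_pow, abs_neg, abs_one, one_pow, abs_of_pos (by positivity)]
    rw [div_le_div_iff₀ (by positivity) h2]
    nlinarith
  have h := (bessel_aux _ hc x).2.const_sub 1
  rw [show J0 = _ from funext J0_eq]
  refine h.congr_deriv ?_
  unfold J1
  congr 1
  refine tsum_congr fun k => ?_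
  ring

/-- `x J₁(x)`. -/
def GG (x : ℝ) : ℝ := x * J1 x

theorem hasDerivAt_GG (x : ℝ) : HasDerivAt GG (x * J0 x) x := by
  have hc : ∀ k : ℕ, |2 * (-1 : ℝ) ^ k / ((k.factorial : ℝ)) ^ 2| ≤
      2 / (k.factorial : ℝ) := by
    intro k
    have h1 : (1 : ℝ) ≤ (k.factorial : ℝ) := by exact_mod_cast Nat.factorial_pos k
    rw [abs_div, abs_mul, abs_pow, abs_neg, abs_one, one_pow, abs_two, abs_of_pos (by positivity)]
    rw [div_le_div_iff₀ (by positivity) (by positivity)]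
    nlinarith
  have h := (bessel_aux _ hc x).2
  have hG : GG = fun x : ℝ => ∑' k : ℕ, (2 * (-1 : ℝ) ^ k / ((k.factorial : ℝ)) ^ 2) / (k + 1) *
      (x / 2) ^ (2 * k + 2) := by
    ext y
    unfold GG J1
    rw [← tsum_mul_left]
    congr 1
    ext k
    have h2 : (k.factorial : ℝ) ≠ 0 := by exact_mod_cast (Nat.factorial_pos k).ne'
    have : (k : ℝ) + 1 ≠ 0 := by positivity
    rw [Nat.factorial_succ]
    push_cast
    field_simp
    ring
  rw [hG]
  refine h.congr_deriv ?_
  unfold J0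
  rw [← tsum_mul_left]
  refine tsum_congr fun k => ?_
  ring

theorem J0_zero : J0 0 = 1 := by
  rw [J0_eq]; simp

theorem GG_zero : GG 0 = 0 := by simp [GG]

theorem continuous_J0 : Continuous J0 :=
  continuous_iff_continuousAt.2 fun x => (hasDerivAt_J0 x).continuousAt

theorem continuous_GG : Continuous GG :=
  continuous_iff_continuousAt.2 fun x => (hasDerivAt_GG x).continuousAt

/-- `x² (J₀² + J₁²)`. -/
def EE (x : ℝ) : ℝ := x ^ 2 * J0 x ^ 2 + GG x ^ 2

theorem hasDerivAt_EE (x : ℝ) : HasDerivAt EE (2 * (J0 x ^ 2 * x)) x := by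
  have h := (((hasDerivAt_id x).pow 2).mul ((hasDerivAt_J0 x).pow 2)).add ((hasDerivAt_GG x).pow 2)
  refine h.congr_deriv ?_
  simp only [GG, id, Pi.pow_apply]
  push_cast
  ring

theorem integral_J0 (x : ℝ) : ∫ r in (0 : ℝ)..x, J0 r ^ 2 * r = EE x / 2 := by
  have h : ∀ y ∈ Set.uIcc 0 x, HasDerivAt (fun y => EE y / 2) (J0 y ^ 2 * y) y := by
    intro y _
    have := (hasDerivAt_EE y).div_const 2
    refine this.congr_deriv ?_
    ring
  rw [intervalIntegral.integral_eq_sub_of_hasDerivAt h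
    (((continuous_J0.pow 2).mul continuous_id).intervalIntegrable _ _)]
  simp [EE, GG_zero]

theorem EE_mono : MonotoneOn EE (Set.Ici 0) := by
  apply monotoneOn_of_hasDerivWithinAt_nonneg (f' := fun x => 2 * (J0 x ^ 2 * x)) (convex_Ici 0)
  · exact fun x _ => (hasDerivAt_EE x).continuousAt.continuousWithinAt
  · exact fun x _ => (hasDerivAt_EE x).hasDerivWithinAt
  · intro x hx
    rw [interior_Ici] at hx
    have : 0 < x := hx
    positivity

theorem EE_pos {x : ℝ} (hx : 0 < x) : 0 < EE x := by
  have h1 : ∀ᶠ y in nhds (0 : ℝ), 0 < J0 y :=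
    continuous_J0.continuousAt.eventually (lt_mem_nhds (by rw [J0_zero]; exact one_pos))
  obtain ⟨ε, hε, h⟩ := Metric.eventually_nhds_iff.1 h1
  set y := min (ε / 2) x with hy
  have hy0 : 0 < y := lt_min (by linarith) hx
  have hJ : 0 < J0 y := h (by
    rw [dist_zero_right, Real.norm_eq_abs, abs_of_pos hy0]
    exact (min_le_left _ _).trans_lt (by linarith))
  have hE : 0 < EE y := by unfold EE; positivity
  exact hE.trans_le (EE_mono hy0.le hx.le (min_le_right _ _))

theorem J0_ne {x : ℝ} (hx : 0 ≤ x) (h : GG x = 0) : J0 x ≠ 0 := by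
  intro h0
  rcases hx.eq_or_lt with rfl | hx
  · rw [J0_zero] at h0; exact one_ne_zero h0
  · have := EE_pos hx
    simp [EE, h, h0] at this

theorem osc (f g : ℝ → ℝ) (hf : ∀ x, HasDerivAt f (- g x) x)
    (hg : ∀ x, HasDerivAt (fun x => x * g x) (x * f x) x) (A : ℝ) (hA : 0 < A)
    (h : ∀ x, A ≤ x → 0 < g x) : False := by
  have hanti : AntitoneOn f (Set.Ici A) := by
    apply antitoneOn_of_hasDerivWithinAt_nonpos (f' := fun x => - g x) (convex_Ici A)
    · exact fun x _ => (hf x).continuousAt.continuousWithinAt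
    · exact fun x _ => (hf x).hasDerivWithinAt
    · intro x hx
      rw [interior_Ici] at hx
      have := h x (le_of_lt hx)
      linarith
  by_cases hpos : ∀ x, A ≤ x → 0 ≤ f x
  · have hm : MonotoneOn (fun x => x * g x) (Set.Ici A) := by
      apply monotoneOn_of_hasDerivWithinAt_nonneg (f' := fun x => x * f x) (convex_Ici A)
      · exact fun x _ => (hg x).continuousAt.continuousWithinAt
      · exact fun x _ => (hg x).hasDerivWithinAt
      · intro x hx
        rw [interior_Ici] at hx
        have hx' : A < x := hx
        exact mul_nonneg (by linarith) (hpos x hx'.le)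
    set c := A * g A with hc
    have hc0 : 0 < c := mul_pos hA (h A le_rfl)
    have hd : ∀ x, A ≤ x → HasDerivAt (fun x => f x + c * Real.log x) (- g x + c * x⁻¹) x :=
      fun x hx => (hf x).add ((Real.hasDerivAt_log (by linarith)).const_mul c)
    have ha : AntitoneOn (fun x => f x + c * Real.log x) (Set.Ici A) := by
      apply antitoneOn_of_hasDerivWithinAt_nonpos (f' := fun x => - g x + c * x⁻¹) (convex_Ici A)
      · exact fun x hx => (hd x hx).continuousAt.continuousWithinAt
      · exact fun x hx => (hd x (interior_subset hx)).hasDerivWithinAt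
      · intro x hx
        rw [interior_Ici] at hx
        have hx' : A < x := hx
        have h1 : c ≤ x * g x := hm (Set.mem_Ici.2 le_rfl) (Set.mem_Ici.2 hx'.le) hx'.le
        have h2 : c * x⁻¹ ≤ g x := by
          rw [← div_eq_mul_inv, div_le_iff₀ (by linarith)]; linarith
        linarith
    have ht : Filter.Tendsto (fun x => c * Real.log x) Filter.atTop Filter.atTop :=
      Real.tendsto_log_atTop.const_mul_atTop hc0
    obtain ⟨x, hx1, hx2⟩ := ((ht.eventually_gt_atTop (f A + c * Real.log A)).and
      (Filter.eventually_ge_atTop A)).exists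
    have h3 : f x + c * Real.log x ≤ f A + c * Real.log A :=
      ha (Set.mem_Ici.2 le_rfl) (Set.mem_Ici.2 hx2) hx2
    linarith [hpos x hx2]
  · push Not at hpos
    obtain ⟨B, hB, hfB⟩ := hpos
    have hd : ∀ x, HasDerivAt (fun x => x * g x - f B * x ^ 2 / 2) (x * f x - f B * x) x := by
      intro x
      have := (hg x).sub ((((hasDerivAt_id x).pow 2).const_mul (f B)).div_const 2)
      refine this.congr_deriv ?_
      simp only [id]
      push_cast
      ring
    have ha : AntitoneOn (fun x => x * g x - f B * x ^ 2 / 2) (Set.Ici B) := by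
      apply antitoneOn_of_hasDerivWithinAt_nonpos (f' := fun x => x * f x - f B * x) (convex_Ici B)
      · exact fun x hx => (hd x).continuousAt.continuousWithinAt
      · exact fun x hx => (hd x).hasDerivWithinAt
      · intro x hx
        rw [interior_Ici] at hx
        have hx' : B < x := hx
        have h1 : f x ≤ f B := hanti (Set.mem_Ici.2 hB) (Set.mem_Ici.2 (hB.trans hx'.le)) hx'.le
        have : 0 < x := by linarith
        nlinarith
    have ht : Filter.Tendsto (fun x : ℝ => (-f B / 2) * x ^ 2) Filter.atTop Filter.atTop :=
      (Filter.tendsto_pow_atTop two_ne_zero).const_mul_atTop (by linarith)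
    obtain ⟨x, hx1, hx2⟩ := ((ht.eventually_gt_atTop (B * g B - f B * B ^ 2 / 2)).and
      (Filter.eventually_ge_atTop B)).exists
    have h3 : x * g x - f B * x ^ 2 / 2 ≤ B * g B - f B * B ^ 2 / 2 :=
      ha (Set.mem_Ici.2 le_rfl) (Set.mem_Ici.2 hx2) hx2
    have h4 : 0 < x * g x := mul_pos (by linarith) (h x (by linarith))
    linarith

theorem exists_zero (A : ℝ) (hA : 0 < A) : ∃ x, A ≤ x ∧ GG x = 0 := by
  by_contra! hne
  have hG : ∀ x, A ≤ x → (0 < GG x ↔ 0 < J1 x) := fun x hx => by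
    unfold GG; exact mul_pos_iff_of_pos_left (by linarith)
  have hsign : ∀ x, A ≤ x → 0 < GG A * GG x := by
    intro x hx
    by_contra! hle
    have hz : (0 : ℝ) ∈ GG '' Set.uIcc A x := by
      apply intermediate_value_uIcc continuous_GG.continuousOn
      rw [Set.mem_uIcc]
      rcases mul_nonpos_iff.1 hle with h | h
      · exact Or.inr ⟨h.2, h.1⟩
      · exact Or.inl ⟨h.1, h.2⟩
    obtain ⟨y, hy, hy0⟩ := hz
    rw [Set.uIcc_of_le hx] at hy
    exact hne y hy.1 hy0
  rcases lt_or_gt_of_ne (hne A le_rfl) with hneg | hpos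
  · refine osc (fun x => - J0 x) (fun x => - J1 x) (fun x => (hasDerivAt_J0 x).neg) ?_ A hA ?_
    · intro x
      have h1 : (fun x => x * -J1 x) = -GG := by
        funext y; simp [GG]
      rw [h1]
      exact (hasDerivAt_GG x).neg.congr_deriv (by ring)
    · intro x hx
      have h1 : GG x < 0 := neg_of_mul_pos_right (hsign x hx) hneg.le
      unfold GG at h1
      have h2 : 0 < x := by linarith
      by_contra! h3
      nlinarith [mul_nonneg h2.le (show 0 ≤ J1 x by linarith)]
  · refine osc J0 J1 hasDerivAt_J0 hasDerivAt_GG A hA ?_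
    intro x hx
    exact (hG x hx).1 (pos_of_mul_pos_right (hsign x hx) hpos.le)

theorem next_zero (z : ℝ) (hz : 0 ≤ z) (h0 : GG z = 0) :
    ∃ w, z < w ∧ GG w = 0 ∧ ∀ x, z < x → x < w → GG x ≠ 0 := by
  have hJ := J0_ne hz h0
  have h1 : ∀ᶠ y in nhds z, J0 y ≠ 0 := continuous_J0.continuousAt.eventually_ne hJ
  obtain ⟨ε, hε, h⟩ := Metric.eventually_nhds_iff.1 h1
  have hnear : ∀ x, z < x → x < z + ε → GG x ≠ 0 := by
    intro x hx hxe hGx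
    obtain ⟨y, hy, hy0⟩ := exists_hasDerivAt_eq_zero hx continuous_GG.continuousOn
      (h0.trans hGx.symm) (fun y _ => hasDerivAt_GG y)
    have hy1 : J0 y ≠ 0 := h (by
      rw [Real.dist_eq, abs_of_pos (by linarith [hy.1])]; linarith [hy.2])
    exact mul_ne_zero (by linarith [hy.1]) hy1 hy0
  set S : Set ℝ := {x | z + ε ≤ x ∧ GG x = 0} with hS
  have hSc : IsClosed S := isClosed_Ici.inter (isClosed_singleton.preimage continuous_GG)
  have hSn : S.Nonempty := exists_zero (z + ε) (by linarith)
  have hSb : BddBelow S := ⟨z + ε, fun x hx => hx.1⟩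
  have hmem := hSc.csInf_mem hSn hSb
  refine ⟨sInf S, by linarith [hmem.1], hmem.2, ?_⟩
  intro x hx hxw hG
  rcases lt_or_ge x (z + ε) with h2 | h2
  · exact hnear x hx h2 hG
  · exact absurd (csInf_le hSb ⟨h2, hG⟩) (not_le.2 hxw)

theorem exists_seq : ∃ z : ℕ → ℝ, z 0 = 0 ∧ StrictMono z ∧ (∀ n, GG (z n) = 0) ∧
    ∀ n x, z n < x → x < z (n + 1) → GG x ≠ 0 := by
  choose w hw1 hw2 hw3 using next_zero
  let s : ℕ → {z : ℝ // 0 ≤ z ∧ GG z = 0} := fun n => Nat.rec ⟨0, le_rfl, GG_zero⟩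
    (fun _ p => ⟨w p.1 p.2.1 p.2.2, p.2.1.trans (hw1 _ _ _).le, hw2 _ _ _⟩) n
  refine ⟨fun n => (s n).1, rfl, strictMono_nat_of_lt_succ fun n => hw1 _ _ _,
    fun n => (s n).2.2, fun n => hw3 _ _ _⟩

theorem Psi_eq (a x : ℝ) : Psi a x = J0 x + 2 * Real.log a * GG x := by
  unfold Psi GG; ring

theorem J0_sign {u v : ℝ} (hu : 0 ≤ u) (huv : u < v) (h1 : GG u = 0) (h2 : GG v = 0)
    (h : ∀ x, u < x → x < v → GG x ≠ 0) : J0 u * J0 v < 0 := by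
  obtain ⟨c, hc, hc0⟩ := exists_hasDerivAt_eq_zero huv continuous_GG.continuousOn
    (h1.trans h2.symm) (fun y _ => hasDerivAt_GG y)
  have hc0' : J0 c = 0 := (mul_eq_zero.1 hc0).resolve_left (by linarith [hc.1])
  by_contra! hge
  have hnu := J0_ne hu h1
  have hnv := J0_ne (by linarith) h2
  -- `J₀²` attains its values: use injectivity of `J₀` on the interval
  have hinj : ∀ x y, u ≤ x → x < y → y ≤ v → J0 x ≠ J0 y := by
    intro x y hx hxy hy he
    obtain ⟨d, hd, hd0⟩ := exists_hasDerivAt_eq_zero hxy continuous_J0.continuousOn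
      he (fun y _ => hasDerivAt_J0 y)
    apply h d (by linarith [hd.1]) (by linarith [hd.2])
    unfold GG
    rw [neg_eq_zero.1 hd0, mul_zero]
  have hI : Set.InjOn J0 (Set.Icc u v) := by
    intro x hx y hy he
    rcases lt_trichotomy x y with h' | h' | h'
    · exact absurd he (hinj x y hx.1 h' hy.2)
    · exact h'
    · exact absurd he.symm (hinj y x hy.1 h' hx.2)
  have hcm : c ∈ Set.Icc u v := ⟨hc.1.le, hc.2.le⟩
  have hum : u ∈ Set.Icc u v := ⟨le_rfl, huv.le⟩
  have hvm : v ∈ Set.Icc u v := ⟨huv.le, le_rfl⟩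
  rcases continuous_J0.continuousOn.strictMonoOn_of_injOn_Icc' huv.le hI with hm | hm
  · have e1 := hm hum hcm hc.1
    have e2 := hm hcm hvm hc.2
    nlinarith
  · have e1 := hm hum hcm hc.1
    have e2 := hm hcm hvm hc.2
    nlinarith

theorem exists_Psi_zero (a : ℝ) {u v : ℝ} (hu : 0 ≤ u) (huv : u < v) (h1 : GG u = 0)
    (h2 : GG v = 0) (h : ∀ x, u < x → x < v → GG x ≠ 0) : ∃ x, u < x ∧ x < v ∧ Psi a x = 0 := by
  have hs := J0_sign hu huv h1 h2 h
  have hPu : Psi a u = J0 u := by rw [Psi_eq, h1]; ring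
  have hPv : Psi a v = J0 v := by rw [Psi_eq, h2]; ring
  have hcont : Continuous (Psi a) := by
    rw [show Psi a = _ from funext (Psi_eq a)]
    exact continuous_J0.add (continuous_const.mul continuous_GG)
  have hz : (0 : ℝ) ∈ Psi a '' Set.uIcc u v := by
    apply intermediate_value_uIcc hcont.continuousOn
    rw [Set.mem_uIcc, hPu, hPv]
    rcases mul_neg_iff.1 hs with h | h
    · exact Or.inr ⟨h.2.le, h.1.le⟩
    · exact Or.inl ⟨h.1.le, h.2.le⟩
  obtain ⟨y, hy, hy0⟩ := hz
  rw [Set.uIcc_of_le huv.le] at hy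
  refine ⟨y, lt_of_le_of_ne hy.1 ?_, lt_of_le_of_ne hy.2 ?_, hy0⟩
  · rintro rfl
    exact J0_ne hu h1 (hPu.symm.trans hy0)
  · rintro rfl
    exact J0_ne (by linarith) h2 (hPv.symm.trans hy0)

theorem Psi_zero_unique (a : ℝ) {u v x y : ℝ} (hu : 0 ≤ u)
    (h : ∀ x, u < x → x < v → GG x ≠ 0) (hx : u < x) (hxy : x < y) (hy : y < v)
    (hPx : Psi a x = 0) (hPy : Psi a y = 0) : False := by
  rw [Psi_eq] at hPx hPy
  have hd : ∀ t, x ≤ t → t ≤ y → HasDerivAt (fun t => J0 t / GG t)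
      ((- J1 t * GG t - J0 t * (t * J0 t)) / GG t ^ 2) t := fun t h1 h2 =>
    (hasDerivAt_J0 t).div (hasDerivAt_GG t) (h t (by linarith) (by linarith))
  have hval : ∀ t, u < t → t < v → J0 t + 2 * Real.log a * GG t = 0 →
      J0 t / GG t = - (2 * Real.log a) := by
    intro t h1 h2 h3
    rw [div_eq_iff (h t h1 h2)]
    linarith
  obtain ⟨t, ht, ht0⟩ := exists_hasDerivAt_eq_zero hxy
    (fun t ht => (hd t ht.1 ht.2).continuousAt.continuousWithinAt)
    ((hval x hx (by linarith) hPx).trans (hval y (by linarith) hy hPy).symm)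
    (fun t ht => hd t ht.1.le ht.2.le)
  have ht1 : 0 < t := by linarith [ht.1]
  have hG := h t (by linarith [ht.1]) (by linarith [ht.2])
  rw [div_eq_zero_iff] at ht0
  have h4 := ht0.resolve_right (pow_ne_zero 2 hG)
  have h5 : EE t = 0 := by
    have : EE t = - t * (- J1 t * GG t - J0 t * (t * J0 t)) := by
      unfold EE GG; ring
    rw [this, h4, mul_zero]
  exact (EE_pos ht1).ne' h5

theorem ratio_eq {a x : ℝ} (hx : 0 < x) (hP : Psi a x = 0) :
    Real.sqrt (2 * π) * |J1 x| / Real.sqrt (∫ r in (0 : ℝ)..x, J0 r ^ 2 * r) =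
      Real.sqrt (4 * π) / (x * Real.sqrt (1 + 4 * |Real.log a| ^ 2 * x ^ 2)) := by
  have hE := EE_pos hx
  have hJ0 : J0 x = - (2 * Real.log a * x * J1 x) := by unfold Psi at hP; linarith
  have hEE : EE x = (x * |J1 x|) ^ 2 * (1 + 4 * |Real.log a| ^ 2 * x ^ 2) := by
    rw [mul_pow, sq_abs, sq_abs]
    unfold EE GG
    rw [hJ0]; ring
  have hJ1 : 0 < |J1 x| := by
    rw [abs_pos]; intro h
    rw [hEE, h] at hE; simp at hE
  have hp : 0 < 1 + 4 * |Real.log a| ^ 2 * x ^ 2 := by positivity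
  rw [integral_J0, Real.sqrt_div' _ (by norm_num), hEE,
    Real.sqrt_mul (show 0 ≤ (x * |J1 x|) ^ 2 by positivity),
    Real.sqrt_sq (show 0 ≤ x * |J1 x| by positivity), show 4 * π = 2 * (2 * π) by ring,
    Real.sqrt_mul (by norm_num) (2 * π)]
  have := Real.sqrt_pos.2 hp
  field_simp

theorem main_aux (j : ℕ) (hj : 2 ≤ j) :
    ∃ (c C a₀ : ℝ), 0 < c ∧ c ≤ C ∧ 0 < a₀ ∧ a₀ < 1 ∧
      ∀ a : ℝ, 0 < a → a < a₀ →
        (∃ s : Finset ℝ, s.card = j ∧ ∀ x ∈ s, 0 < x ∧ Psi a x = 0) ∧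
        ∃ μ : ℝ, 0 < μ ∧ Psi a μ = 0 ∧
          {x : ℝ | 0 < x ∧ x < μ ∧ Psi a x = 0}.ncard = j - 1 ∧
          c * |Real.log a|⁻¹ ≤
            Real.sqrt (2 * π) * |J1 μ| / Real.sqrt (∫ r in (0 : ℝ)..μ, J0 r ^ 2 * r) ∧
          Real.sqrt (2 * π) * |J1 μ| / Real.sqrt (∫ r in (0 : ℝ)..μ, J0 r ^ 2 * r) ≤
            C * |Real.log a|⁻¹ := by
  obtain ⟨z, hz0, hzm, hzG, hzn⟩ := exists_seq
  obtain ⟨n, rfl⟩ : ∃ n, j = n + 1 := ⟨j - 1, by omega⟩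
  have hznn : ∀ k, 0 ≤ z k := fun k => hz0 ▸ hzm.monotone (Nat.zero_le k)
  have hzp : 0 < z n := hz0 ▸ hzm (show 0 < n by omega)
  have hzp' : 0 < z (n + 1) := hz0 ▸ hzm (Nat.succ_pos n)
  have hpi : 0 < Real.sqrt (4 * π) := Real.sqrt_pos.2 (by positivity)
  set c := Real.sqrt (4 * π) / (z (n + 1) * Real.sqrt (1 + 4 * z (n + 1) ^ 2)) with hc
  set C := Real.sqrt (4 * π) / (z n * (2 * z n)) with hC
  refine ⟨c, max c C, Real.exp (-1), by positivity, le_max_left _ _, Real.exp_pos _,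
    by rw [Real.exp_lt_one_iff]; norm_num, ?_⟩
  intro a ha0 ha
  have hlog : Real.log a < -1 := by
    rw [← Real.log_exp (-1)]; exact Real.log_lt_log ha0 ha
  have hl : 1 ≤ |Real.log a| := by rw [abs_of_neg (by linarith)]; linarith
  set l := |Real.log a| with hldef
  choose m hm1 hm2 hm3 using fun k =>
    exists_Psi_zero a (hznn k) (hzm (Nat.lt_succ_self k)) (hzG k) (hzG (k + 1)) (hzn k)
  have hmm : StrictMono m := strictMono_nat_of_lt_succ fun k => (hm2 k).trans (hm1 (k + 1))
  have hmp : ∀ k, 0 < m k := fun k => (hznn k).trans_lt (hm1 k)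
  refine ⟨⟨(Finset.range (n + 1)).image m, ?_, ?_⟩, m n, hmp n, hm3 n, ?_, ?_⟩
  · rw [Finset.card_image_of_injective _ hmm.injective, Finset.card_range]
  · intro x hx
    obtain ⟨k, _, rfl⟩ := Finset.mem_image.1 hx
    exact ⟨hmp k, hm3 k⟩
  · have hloc : ∀ N : ℕ, ∀ x, 0 < x → x < z N → ∃ k, z k ≤ x ∧ x < z (k + 1) := by
      intro N
      induction N with
      | zero => intro x h1 h2; rw [hz0] at h2; linarith
      | succ N ih =>
        intro x h1 h2
        rcases lt_or_ge x (z N) with h | h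
        · exact ih x h1 h
        · exact ⟨N, h, h2⟩
    have hset : {x : ℝ | 0 < x ∧ x < m n ∧ Psi a x = 0} =
        (((Finset.range n).image m : Finset ℝ) : Set ℝ) := by
      ext x
      simp only [Set.mem_ofPred_eq, Finset.coe_image, Set.mem_image, Finset.coe_range, Set.mem_Iio]
      constructor
      · rintro ⟨h1, h2, h3⟩
        obtain ⟨k, hk1, hk2⟩ := hloc (n + 1) x h1 (h2.trans (hm2 n))
        have hk1' : z k < x := by
          refine lt_of_le_of_ne hk1 ?_
          rintro rfl
          rw [Psi_eq, hzG k, mul_zero, add_zero] at h3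
          exact J0_ne (hznn k) (hzG k) h3
        have hx : m k = x := by
          rcases lt_trichotomy (m k) x with h | h | h
          · exact (Psi_zero_unique a (hznn k) (hzn k) (hm1 k) h hk2 (hm3 k) h3).elim
          · exact h
          · exact (Psi_zero_unique a (hznn k) (hzn k) hk1' h (hm2 k) h3 (hm3 k)).elim
        refine ⟨k, ?_, hx⟩
        rw [← hx] at h2
        exact hmm.lt_iff_lt.1 h2
      · rintro ⟨k, hk, rfl⟩
        exact ⟨hmp k, hmm hk, hm3 k⟩
    rw [hset, Set.ncard_coe_finset, Finset.card_image_of_injective _ hmm.injective,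
      Finset.card_range]
    rfl
  · rw [ratio_eq (hmp n) (hm3 n)]
    have h1 := hm1 n
    have h2 := hm2 n
    have h0 := hmp n
    set x := m n
    have hl0 : 0 < l := by linarith
    have hlow : Real.sqrt (1 + 4 * l ^ 2 * x ^ 2) ≤ l * Real.sqrt (1 + 4 * z (n + 1) ^ 2) := by
      rw [Real.sqrt_le_left (by positivity), mul_pow, Real.sq_sqrt (by positivity)]
      have e1 : x ^ 2 ≤ z (n + 1) ^ 2 := by gcongr
      have e2 : 1 ≤ l ^ 2 := by nlinarith
      nlinarith [mul_le_mul_of_nonneg_left e1 (sq_nonneg l)]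
    have hup : 2 * l * z n ≤ Real.sqrt (1 + 4 * l ^ 2 * x ^ 2) := by
      apply Real.le_sqrt_of_sq_le
      have e1 : z n ^ 2 ≤ x ^ 2 := by gcongr
      nlinarith [mul_le_mul_of_nonneg_left e1 (sq_nonneg l)]
    constructor
    · have : c * l⁻¹ = Real.sqrt (4 * π) /
          (z (n + 1) * (l * Real.sqrt (1 + 4 * z (n + 1) ^ 2))) := by
        rw [hc]; field_simp
      rw [this]
      gcongr
    · calc _ ≤ Real.sqrt (4 * π) / (z n * (2 * l * z n)) := by gcongr
        _ = C * l⁻¹ := by rw [hC]; field_simp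
        _ ≤ _ := by gcongr; exact le_max_right _ _

/-- For `j ≥ 2`, `Ψ_a` has at least `j` positive zeros, and the quantity
`√(2π) |J₁(μ_j(a))| / (∫₀^{μ_j(a)} J₀(r)² r dr)^{1/2}` attached to its `j`-th smallest positive
zero `μ_j(a)` (this quantity equals `a⁻¹ |∫_{D_a} v_{0,j}|`) is comparable to `|log a|⁻¹`. -/
theorem integral_higher_radial_eigenfunction_disc (j : ℕ) (hj : 2 ≤ j) :
    ∃ (c C a₀ : ℝ), 0 < c ∧ c ≤ C ∧ 0 < a₀ ∧ a₀ < 1 ∧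
      ∀ a : ℝ, 0 < a → a < a₀ →
        (∃ s : Finset ℝ, s.card = j ∧ ∀ x ∈ s, 0 < x ∧ Psi a x = 0) ∧
        ∃ μ : ℝ, 0 < μ ∧ Psi a μ = 0 ∧
          {x : ℝ | 0 < x ∧ x < μ ∧ Psi a x = 0}.ncard = j - 1 ∧
          c * |Real.log a|⁻¹ ≤
            Real.sqrt (2 * π) * |J1 μ| / Real.sqrt (∫ r in (0 : ℝ)..μ, J0 r ^ 2 * r) ∧
          Real.sqrt (2 * π) * |J1 μ| / Real.sqrt (∫ r in (0 : ℝ)..μ, J0 r ^ 2 * r) ≤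
            C * |Real.log a|⁻¹ :=
  main_aux j hj

end
end

section
/- Domain monotonicity of the eigenvalues of the Newtonian potential operator: let d ∈ {2, 3} and let Ω₁ ⊆ Ω₂ be bounded measurable subsets of ℝ^d of positive Lebesgue measure. Then for every integer k ≥ 0, λₖ(Ω₁) ≤ λₖ(Ω₂). -/
open MeasureTheory Real

noncomputable section

/-- The fundamental solution of the Laplacian: the logarithmic kernel when `d = 2`
and the Newtonian kernel when `d = 3`. -/
def fundKernel (d : ℕ) (x y : EuclideanSpace ℝ (Fin d)) : ℝ :=
  if d = 2 then -(1 / (2 * π)) * Real.log (dist x y) else 1 / (4 * π * dist x y)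

/-- The Newtonian potential operator `N_Ω` in dimension `d`. -/
def NOpD (d : ℕ) (Ω : Set (EuclideanSpace ℝ (Fin d))) (f : EuclideanSpace ℝ (Fin d) → ℝ)
    (x : EuclideanSpace ℝ (Fin d)) : ℝ := ∫ y in Ω, fundKernel d x y * f y

/-- The quadratic form `⟨N_Ω u, u⟩` on `L²(Ω)`. -/
def quadFormD (d : ℕ) (Ω : Set (EuclideanSpace ℝ (Fin d)))
    (u : Lp ℝ 2 (volume.restrict Ω)) : ℝ :=
  ∫ x in Ω, NOpD d Ω u x * u x

/-- The `k`-th eigenvalue of the Newtonian potential operator, via the max–min principle. -/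
def eigenD (d : ℕ) (Ω : Set (EuclideanSpace ℝ (Fin d))) (k : ℕ) : ℝ :=
  sSup {r : ℝ | ∃ Ξ : Submodule ℝ (Lp ℝ 2 (volume.restrict Ω)),
    Module.finrank ℝ ↥Ξ = k + 1 ∧
    r = sInf {q : ℝ | ∃ u ∈ Ξ, u ≠ 0 ∧ q = quadFormD d Ω u / ‖u‖ ^ 2}}

theorem abs_fundKernel_le (d : ℕ) (x y : EuclideanSpace ℝ (Fin d)) :
    |fundKernel d x y| ≤ ‖x - y‖⁻¹ + ‖x - y‖ := by
  unfold fundKernel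
  rw [dist_eq_norm]
  have ht : 0 ≤ ‖x - y‖ := norm_nonneg _
  generalize ‖x - y‖ = t at ht
  have hpi := Real.pi_gt_three
  rcases ht.eq_or_lt with rfl | ht
  · split_ifs <;> simp
  have hinv : 0 < t⁻¹ := inv_pos.2 ht
  split_ifs
  · rw [abs_mul, abs_neg]
    have h1 : |1 / (2 * π)| ≤ 1 := by
      rw [abs_of_pos (by positivity), div_le_one (by positivity)]; linarith
    have h2 : |Real.log t| ≤ t⁻¹ + t := by
      rw [abs_le]
      have a := Real.log_le_self ht.le
      have b := Real.log_le_self hinv.le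
      rw [Real.log_inv] at b
      constructor <;> linarith
    calc _ ≤ 1 * |Real.log t| := by gcongr
      _ ≤ _ := by linarith
  · rw [abs_of_pos (by positivity), one_div, mul_inv]
    have : (4 * π)⁻¹ ≤ 1 := inv_le_one_of_one_le₀ (by linarith)
    nlinarith

theorem integrable_radial (d : ℕ) (hd : d = 2 ∨ d = 3) (R : ℝ) :
    Integrable (fun z : EuclideanSpace ℝ (Fin d) =>
      (Set.Iic R).indicator (fun t : ℝ => t⁻¹ + t) ‖z‖) := by
  have : Nontrivial (EuclideanSpace ℝ (Fin d)) := by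
    rcases hd with rfl | rfl <;> infer_instance
  rw [integrable_fun_norm_addHaar]
  have hc : IntegrableOn (fun t : ℝ => t ^ (d - 2) * (1 + t ^ 2)) (Set.Icc 0 R) :=
    (by fun_prop : Continuous fun t : ℝ => t ^ (d - 2) * (1 + t ^ 2)).continuousOn.integrableOn_Icc
  have hi : Integrable ((Set.Icc 0 R).indicator fun t : ℝ => t ^ (d - 2) * (1 + t ^ 2)) :=
    (integrable_indicator_iff measurableSet_Icc).2 hc
  refine (hi.integrableOn (s := Set.Ioi 0)).congr_fun ?_ measurableSet_Ioi
  intro t ht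
  have ht : 0 < t := ht
  by_cases h : t ≤ R
  · rw [Set.indicator_of_mem (show t ∈ Set.Icc 0 R from ⟨ht.le, h⟩)]
    simp only [finrank_euclideanSpace_fin, smul_eq_mul]
    rw [Set.indicator_of_mem (show t ∈ Set.Iic R from h)]
    have : d - 1 = (d - 2) + 1 := by omega
    rw [this, pow_succ]
    field_simp
    ring
  · rw [Set.indicator_of_notMem (show t ∉ Set.Icc 0 R from fun h' => h h'.2)]
    simp only
    rw [Set.indicator_of_notMem (show t ∉ Set.Iic R from h), smul_zero]

theorem schur_bound (d : ℕ) (hd : d = 2 ∨ d = 3) (Ω : Set (EuclideanSpace ℝ (Fin d)))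
    (hb : Bornology.IsBounded Ω) (hm : MeasurableSet Ω) :
    ∃ M : ENNReal, M ≠ ⊤ ∧ ∀ x ∈ Ω, ∫⁻ y in Ω, ‖fundKernel d x y‖ₑ ≤ M := by
  obtain ⟨R, hR⟩ := Metric.isBounded_iff.1 hb
  have hi := integrable_radial d hd R
  refine ⟨_, hi.2.ne, fun x hx => ?_⟩
  rw [← lintegral_sub_left_eq_self (μ := volume) (fun z : EuclideanSpace ℝ (Fin d) =>
    ‖(Set.Iic R).indicator (fun t : ℝ => t⁻¹ + t) ‖z‖‖ₑ) x]
  refine le_trans (setLIntegral_mono' hm fun y hy => ?_) (setLIntegral_le_lintegral Ω _)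
  have hxy : ‖x - y‖ ≤ R := by rw [← dist_eq_norm]; exact hR hx hy
  rw [Set.indicator_of_mem (show ‖x - y‖ ∈ Set.Iic R from hxy)]
  rw [← ofReal_norm, ← ofReal_norm]
  apply ENNReal.ofReal_le_ofReal
  rw [Real.norm_eq_abs, Real.norm_eq_abs]
  exact (abs_fundKernel_le d x y).trans (le_abs_self _)

theorem measurable_fundKernel (d : ℕ) :
    Measurable (Function.uncurry (fundKernel d)) := by
  unfold fundKernel Function.uncurry
  split_ifs
  · fun_prop
  · fun_prop

theorem fundKernel_comm (d : ℕ) (x y : EuclideanSpace ℝ (Fin d)) :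
    fundKernel d x y = fundKernel d y x := by
  unfold fundKernel; rw [dist_comm]

theorem quadForm_bound (d : ℕ) (hd : d = 2 ∨ d = 3) (Ω : Set (EuclideanSpace ℝ (Fin d)))
    (hb : Bornology.IsBounded Ω) (hm : MeasurableSet Ω) :
    ∃ C : ℝ, 0 ≤ C ∧ ∀ u : Lp ℝ 2 (volume.restrict Ω), |quadFormD d Ω u| ≤ C * ‖u‖ ^ 2 := by
  obtain ⟨M, hM, hK⟩ := schur_bound d hd Ω hb hm
  refine ⟨(2 * M).toReal, ENNReal.toReal_nonneg, fun u => ?_⟩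
  have hu : Measurable (u : EuclideanSpace ℝ (Fin d) → ℝ) := (Lp.stronglyMeasurable u).measurable
  have hmk := measurable_fundKernel d
  have hnorm : ∫⁻ x in Ω, ‖u x‖ₑ ^ 2 = ‖u‖ₑ ^ 2 := by
    rw [Lp.enorm_def]
    have := eLpNorm_nnreal_pow_eq_lintegral (μ := volume.restrict Ω) (f := u) (p := 2) (by norm_num)
    simpa using this.symm
  have e1 : ∫⁻ x in Ω, ∫⁻ y in Ω, ‖fundKernel d x y‖ₑ * ‖u x‖ₑ ^ 2 ≤ M * ‖u‖ₑ ^ 2 := by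
    rw [← hnorm, ← lintegral_const_mul' _ _ hM]
    refine setLIntegral_mono' hm fun x hx => ?_
    rw [lintegral_mul_const _ (by fun_prop)]
    gcongr
    exact hK x hx
  have hmu : Measurable (Function.uncurry fun x y : EuclideanSpace ℝ (Fin d) =>
      ‖fundKernel d x y‖ₑ * ‖u x‖ₑ ^ 2) :=
    (hmk.enorm).mul ((hu.comp measurable_fst).enorm.pow_const 2)
  have e2 : ∫⁻ x in Ω, ∫⁻ y in Ω, ‖fundKernel d x y‖ₑ * ‖u y‖ₑ ^ 2 ≤ M * ‖u‖ₑ ^ 2 := by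
    rw [lintegral_lintegral_swap]
    · refine le_trans (le_of_eq ?_) e1
      refine lintegral_congr fun y => lintegral_congr fun x => ?_
      rw [fundKernel_comm]
    · exact ((hmk.enorm).mul ((hu.comp measurable_snd).enorm.pow_const 2)).aemeasurable
  have key : ‖quadFormD d Ω u‖ₑ ≤ 2 * M * ‖u‖ₑ ^ 2 := by
    unfold quadFormD NOpD
    calc _ ≤ ∫⁻ x in Ω, ‖(∫ y in Ω, fundKernel d x y * u y) * u x‖ₑ :=
          enorm_integral_le_lintegral_enorm _
      _ ≤ ∫⁻ x in Ω, ((∫⁻ y in Ω, ‖fundKernel d x y‖ₑ * ‖u x‖ₑ ^ 2)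
            + ∫⁻ y in Ω, ‖fundKernel d x y‖ₑ * ‖u y‖ₑ ^ 2) := by
          refine lintegral_mono fun x => ?_
          rw [enorm_mul, ← lintegral_add_left (by fun_prop)]
          calc _ ≤ (∫⁻ y in Ω, ‖fundKernel d x y * u y‖ₑ) * ‖u x‖ₑ := by
                gcongr; exact enorm_integral_le_lintegral_enorm _
            _ = ∫⁻ y in Ω, ‖fundKernel d x y * u y‖ₑ * ‖u x‖ₑ := by
                rw [lintegral_mul_const _ (by fun_prop)]
            _ ≤ _ := by
                refine lintegral_mono fun y => ?_
                rw [enorm_mul, mul_assoc, ← mul_add]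
                gcongr
                rcases le_total ‖u x‖ₑ ‖u y‖ₑ with h | h
                · calc _ ≤ ‖u y‖ₑ * ‖u y‖ₑ := by gcongr
                    _ ≤ _ := by rw [← sq]; exact le_add_self
                · calc _ ≤ ‖u x‖ₑ * ‖u x‖ₑ := by gcongr
                    _ ≤ _ := by rw [← sq]; exact le_self_add
      _ = _ := lintegral_add_left hmu.lintegral_prod_right' _
      _ ≤ M * ‖u‖ₑ ^ 2 + M * ‖u‖ₑ ^ 2 := add_le_add e1 e2
      _ = _ := by ring
  have hfin : 2 * M * ‖u‖ₑ ^ 2 ≠ ⊤ :=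
    ENNReal.mul_ne_top (ENNReal.mul_ne_top (by simp) hM) (by simp)
  have := ENNReal.toReal_mono hfin key
  simpa [ENNReal.toReal_mul, ENNReal.toReal_pow] using this

theorem exists_submodule (d : ℕ) (hd : d = 2 ∨ d = 3) (Ω : Set (EuclideanSpace ℝ (Fin d)))
    (hb : Bornology.IsBounded Ω) (hμ : 0 < volume Ω) (n : ℕ) :
    ∃ Ξ : Submodule ℝ (Lp ℝ 2 (volume.restrict Ω)), Module.finrank ℝ ↥Ξ = n := by
  have : Nontrivial (EuclideanSpace ℝ (Fin d)) := by
    rcases hd with rfl | rfl <;> infer_instance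
  have : IsFiniteMeasure (volume.restrict Ω) := ⟨by
    rw [Measure.restrict_apply_univ]; exact hb.measure_lt_top⟩
  have hinf : (volume.restrict Ω).support.Infinite := by
    intro hf
    have h0 : (volume.restrict Ω) (volume.restrict Ω).support = 0 := hf.measure_zero _
    have h1 : (volume.restrict Ω) (volume.restrict Ω).supportᶜ = 0 := Measure.measure_compl_support
    have h2 : (volume.restrict Ω) Set.univ = 0 := by
      rw [← Set.union_compl_self (volume.restrict Ω).support]
      exact measure_union_null h0 h1
    rw [Measure.restrict_apply_univ] at h2
    exact hμ.ne' h2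
  obtain ⟨t, hts, htn⟩ := hinf.exists_subset_card_eq n
  obtain ⟨U, hU, hdis⟩ := t.finite_toSet.t2_separation
  let v : t → Lp ℝ 2 (volume.restrict Ω) := fun i =>
    indicatorConstLp 2 (hU i).2.measurableSet (measure_ne_top _ _) (1 : ℝ)
  have hv : LinearIndependent ℝ v := by
    refine linearIndependent_of_ne_zero_of_inner_eq_zero (𝕜 := ℝ) ?_ ?_
    · intro i hi
      have hpos := (Measure.mem_support_iff_forall _).1 (hts i.2) (U i)
        ((hU i).2.mem_nhds (hU i).1)
      have h3 : inner ℝ (v i) (v i) = 0 := by rw [hi, inner_zero_left]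
      simp only [v] at h3
      rw [L2.real_inner_indicatorConstLp_one_indicatorConstLp_one, Set.inter_self,
        measureReal_eq_zero_iff] at h3
      exact hpos.ne' h3
    · intro i j hij
      simp only [v]
      rw [L2.real_inner_indicatorConstLp_one_indicatorConstLp_one]
      have := hdis i.2 j.2 (fun h => hij (Subtype.ext h))
      rw [Set.disjoint_iff_inter_eq_empty.1 this]
      simp
  exact ⟨_, (finrank_span_eq_card hv).trans (by simp [htn])⟩

theorem exists_extension (d : ℕ) (Ω₁ Ω₂ : Set (EuclideanSpace ℝ (Fin d))) (hsub : Ω₁ ⊆ Ω₂)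
    (hm₁ : MeasurableSet Ω₁) :
    ∃ e : Lp ℝ 2 (volume.restrict Ω₁) →ₗ[ℝ] Lp ℝ 2 (volume.restrict Ω₂),
      ∀ u, ‖e u‖ = ‖u‖ ∧ quadFormD d Ω₂ (e u) = quadFormD d Ω₁ u := by
  have hrr : ((volume : Measure (EuclideanSpace ℝ (Fin d))).restrict Ω₂).restrict Ω₁
      = volume.restrict Ω₁ := Measure.restrict_restrict_of_subset hsub
  have hmem : ∀ u : Lp ℝ 2 (volume.restrict Ω₁),
      MemLp (Ω₁.indicator u) 2 (volume.restrict Ω₂) := fun u => by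
    rw [memLp_indicator_iff_restrict hm₁, hrr]; exact Lp.memLp u
  have hext : ∀ f g : EuclideanSpace ℝ (Fin d) → ℝ, f =ᵐ[volume.restrict Ω₁] g →
      Ω₁.indicator f =ᵐ[volume.restrict Ω₂] Ω₁.indicator g := fun f g h => by
    rw [← hrr] at h
    filter_upwards [(ae_restrict_iff' hm₁).1 h] with y hy
    by_cases h : y ∈ Ω₁
    · simp [h, hy h]
    · simp [h]
  refine ⟨⟨⟨fun u => (hmem u).toLp _, ?_⟩, ?_⟩, fun u => ⟨?_, ?_⟩⟩
  · intro u v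
    rw [← MemLp.toLp_add, MemLp.toLp_eq_toLp_iff, ← Set.indicator_add']
    exact hext _ _ (Lp.coeFn_add u v)
  · intro c u
    simp only [RingHom.id_apply]
    rw [← MemLp.toLp_const_smul, MemLp.toLp_eq_toLp_iff]
    rw [show c • Ω₁.indicator (u : EuclideanSpace ℝ (Fin d) → ℝ) = Ω₁.indicator (c • ⇑u) from by
      ext y; by_cases h : y ∈ Ω₁ <;> simp [h]]
    exact hext _ _ (Lp.coeFn_smul c u)
  · change ‖(hmem u).toLp _‖ = ‖u‖
    rw [Lp.norm_toLp, Lp.norm_def, eLpNorm_indicator_eq_eLpNorm_restrict hm₁, hrr]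
  · change quadFormD d Ω₂ ((hmem u).toLp _) = _
    have hae := (hmem u).coeFn_toLp
    have hI : ∀ g : EuclideanSpace ℝ (Fin d) → ℝ,
        ∫ y in Ω₂, g y * (hmem u).toLp _ y = ∫ y in Ω₁, g y * u y := fun g => by
      have h1 : ∫ y in Ω₁, g y * u y = ∫ y in Ω₂, Ω₁.indicator (fun y => g y * u y) y := by
        rw [integral_indicator hm₁, hrr]
      rw [h1]
      refine integral_congr_ae ?_
      filter_upwards [hae] with y hy
      rw [hy]
      by_cases h : y ∈ Ω₁ <;> simp [h]
    have hN : ∀ x, NOpD d Ω₂ ((hmem u).toLp _) x = NOpD d Ω₁ u x := fun x => by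
      unfold NOpD
      exact hI (fundKernel d x)
    unfold quadFormD
    simp_rw [hN]
    exact hI (NOpD d Ω₁ u)

/-- Domain monotonicity of the eigenvalues of the Newtonian potential operator:
if `Ω₁ ⊆ Ω₂` then `λₖ(Ω₁) ≤ λₖ(Ω₂)` for every `k`. -/
theorem eigen_domain_monotonicity (d : ℕ) (hd : d = 2 ∨ d = 3)
    (Ω₁ Ω₂ : Set (EuclideanSpace ℝ (Fin d))) (hsub : Ω₁ ⊆ Ω₂)
    (hb₁ : Bornology.IsBounded Ω₁) (hb₂ : Bornology.IsBounded Ω₂)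
    (hm₁ : MeasurableSet Ω₁) (hm₂ : MeasurableSet Ω₂)
    (hμ₁ : 0 < volume Ω₁) (hμ₂ : 0 < volume Ω₂) :
    ∀ k : ℕ, eigenD d Ω₁ k ≤ eigenD d Ω₂ k := by
  intro k
  obtain ⟨C, hC0, hC⟩ := quadForm_bound d hd Ω₂ hb₂ hm₂
  obtain ⟨e, he⟩ := exists_extension d Ω₁ Ω₂ hsub hm₁
  have hinj : Function.Injective e := by
    rw [injective_iff_map_eq_zero]
    intro u hu
    have := (he u).1
    rw [hu, norm_zero] at this
    exact norm_eq_zero.1 this.symm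
  unfold eigenD
  apply csSup_le_csSup
  · refine ⟨C, ?_⟩
    rintro r ⟨Ξ, hΞ, rfl⟩
    have hq : ∀ u : Lp ℝ 2 (volume.restrict Ω₂), u ≠ 0 →
        |quadFormD d Ω₂ u / ‖u‖ ^ 2| ≤ C := fun u hu => by
      have : 0 < ‖u‖ ^ 2 := by positivity
      rw [abs_div, abs_of_pos this, div_le_iff₀ this]
      exact hC u
    have : Nontrivial Ξ := Module.nontrivial_of_finrank_pos (R := ℝ) (by omega)
    obtain ⟨u, hu⟩ := exists_ne (0 : Ξ)
    have hu' : (u : Lp ℝ 2 (volume.restrict Ω₂)) ≠ 0 := fun h => hu (Subtype.ext h)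
    refine le_trans (csInf_le ?_ ⟨u, u.2, hu', rfl⟩) (abs_le.1 (hq u hu')).2
    refine ⟨-C, ?_⟩
    rintro q ⟨w, -, hw, rfl⟩
    exact (abs_le.1 (hq w hw)).1
  · obtain ⟨Ξ, hΞ⟩ := exists_submodule d hd Ω₁ hb₁ hμ₁ (k + 1)
    exact ⟨_, Ξ, hΞ, rfl⟩
  · rintro r ⟨Ξ, hΞ, rfl⟩
    refine ⟨Ξ.map e, ?_, ?_⟩
    · rw [← hΞ]
      exact (LinearEquiv.finrank_eq (Submodule.equivMapOfInjective e hinj Ξ)).symm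
    · congr 1
      ext q
      constructor
      · rintro ⟨u, hu, hu0, rfl⟩
        refine ⟨e u, Submodule.mem_map_of_mem hu, (map_ne_zero_iff e hinj).2 hu0, ?_⟩
        rw [(he u).1, (he u).2]
      · rintro ⟨w, ⟨u, hu, rfl⟩, hw, rfl⟩
        refine ⟨u, hu, (map_ne_zero_iff e hinj).1 hw, ?_⟩
        rw [(he u).1, (he u).2]

end
end
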